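/- arXiv:2411.06301 — 3 statements merged into one kernel-verified Lean document; each statement's English description precedes it below -/
import Mathlib

section
/- Let S_0 = {λ ∈ [0,∞]^d : lim_n |g^{(n)}(λ)| = 0} and S_∞ = {λ ∈ [0,∞]^d : limsup_n |g^{(n)}(λ)| = ∞}. Under the hypotheses of the main theorem, S_0 and S_∞ are relatively open subsets of [0,∞]^d, they are disjoint, and both satisfy g(S) ⊂ S and g^{-1}(S) ⊂ S. -/
open MeasureTheory ProbabilityTheory ENNReal Filter Set

/-- Extended exponential `[0,∞] → [1,∞]`. -/
noncomputable def eexp (x : ℝ≥0∞) : ℝ≥0∞ :=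
  if x = ⊤ then ⊤ else ENNReal.ofReal (Real.exp x.toReal)

/-- Extended logarithm, suitable for values in `[1,∞]`. -/
noncomputable def elog (y : ℝ≥0∞) : ℝ≥0∞ :=
  if y = ⊤ then ⊤ else ENNReal.ofReal (Real.log y.toReal)

/-- The generating function of the `n`-th generation of a `d`-type branching process:
`F P X n q k = 𝔼ₖ[∏ⱼ qⱼ ^ Xⱼ(n)]`, where `P k` is the law of the process started from a
single individual of type `k`. Values are in `[0,∞]`, with the conventions `∞ ^ 0 = 1`
and `∞ ^ x = ∞` for `x > 0` built into `ℝ≥0∞`. -/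
noncomputable def genFun {d : ℕ} {Ω : Type*} [MeasurableSpace Ω]
    (P : Fin d → Measure Ω) (X : ℕ → Ω → Fin d → ℕ) (n : ℕ)
    (q : Fin d → ℝ≥0∞) : Fin d → ℝ≥0∞ :=
  fun k => ∫⁻ ω, ∏ j, (q j) ^ (X n ω j) ∂ (P k)

/-- The log-Laplace transform of the `n`-th generation:
`logGenFun P X n λ k = log 𝔼ₖ[exp (∑ⱼ λⱼ Xⱼ(n))]`, i.e. `g⁽ⁿ⁾(λ) = log f⁽ⁿ⁾(e^λ)`
componentwise, viewed as a map `[0,∞]^d → [0,∞]^d`. -/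
noncomputable def logGenFun {d : ℕ} {Ω : Type*} [MeasurableSpace Ω]
    (P : Fin d → Measure Ω) (X : ℕ → Ω → Fin d → ℕ) (n : ℕ)
    (l : Fin d → ℝ≥0∞) : Fin d → ℝ≥0∞ :=
  fun k => elog (genFun P X n (fun j => eexp (l j)) k)

/-- The event that the branching process eventually becomes extinct. -/
def ExtinctionEvent {d : ℕ} {Ω : Type*} (X : ℕ → Ω → Fin d → ℕ) : Set Ω :=
  {ω | ∃ N, ∀ n ≥ N, X n ω = 0}

/-- Positive regularity: for some `N`, started from any type `k`, there is a positive
chance of having an individual of type `j` in generation `N`, for every `j`. -/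
def PositiveRegular {d : ℕ} {Ω : Type*} [MeasurableSpace Ω]
    (P : Fin d → Measure Ω) (X : ℕ → Ω → Fin d → ℕ) : Prop :=
  ∃ N, ∀ k j, 0 < P k {ω | 1 ≤ X N ω j}

/-- Non-singularity: some type has a positive chance of at least two total offspring. -/
def NonSingular {d : ℕ} {Ω : Type*} [MeasurableSpace Ω]
    (P : Fin d → Measure Ω) (X : ℕ → Ω → Fin d → ℕ) : Prop :=
  ∃ k, 0 < P k {ω | 2 ≤ ∑ j, X 1 ω j}

/-- The mean matrix `M k j = 𝔼ₖ[Xⱼ(1)]`. -/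
noncomputable def meanMatrix {d : ℕ} {Ω : Type*} [MeasurableSpace Ω]
    (P : Fin d → Measure Ω) (X : ℕ → Ω → Fin d → ℕ) : Matrix (Fin d) (Fin d) ℝ :=
  fun k j => (∫⁻ ω, (X 1 ω j : ℝ≥0∞) ∂ (P k)).toReal

/-- Subcriticality: the mean matrix has finite entries and all of its (complex)
eigenvalues have modulus `< 1`; for a nonnegative matrix this says exactly that the
largest (Perron–Frobenius) eigenvalue is `< 1`. -/
def Subcritical {d : ℕ} {Ω : Type*} [MeasurableSpace Ω]
    (P : Fin d → Measure Ω) (X : ℕ → Ω → Fin d → ℕ) : Prop :=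
  (∀ k j, ∫⁻ ω, (X 1 ω j : ℝ≥0∞) ∂ (P k) ≠ ⊤) ∧
    ∀ μ ∈ spectrum ℂ ((meanMatrix P X).map (Complex.ofReal)), ‖μ‖ < 1

/-- Continuity of each component of the generating function on `(0,∞]^d`
(Hypothesis III of the main theorem). -/
def GenFunContinuous {d : ℕ} {Ω : Type*} [MeasurableSpace Ω]
    (P : Fin d → Measure Ω) (X : ℕ → Ω → Fin d → ℕ) : Prop :=
  ∀ k, ContinuousOn (fun q => genFun P X 1 q k) {q : Fin d → ℝ≥0∞ | ∀ j, 0 < q j}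

/-- The basin of attraction of `0` for the iterated map `g(λ) = log f(e^λ)`
on `[0,∞]^d`. -/
def basinZero {d : ℕ} {Ω : Type*} [MeasurableSpace Ω]
    (P : Fin d → Measure Ω) (X : ℕ → Ω → Fin d → ℕ) : Set (Fin d → ℝ≥0∞) :=
  {l | Tendsto (fun n => (logGenFun P X 1)^[n] l) atTop (nhds 0)}

/-- The basin of attraction of `∞`: the points where `limsup_n |g⁽ⁿ⁾(λ)| = ∞`. -/
def basinInfty {d : ℕ} {Ω : Type*} [MeasurableSpace Ω]
    (P : Fin d → Measure Ω) (X : ℕ → Ω → Fin d → ℕ) : Set (Fin d → ℝ≥0∞) :=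
  {l | limsup (fun n => ∑ k, (logGenFun P X 1)^[n] l k) atTop = ⊤}

namespace Basins

lemma eexp_eq (x : ℝ≥0∞) : eexp x = EReal.exp (x : EReal) := by
  unfold eexp
  split_ifs with h
  · simp [h]
  · lift x to NNReal using h
    rfl

lemma elog_eq (y : ℝ≥0∞) : elog y = (ENNReal.log y).toENNReal := by
  unfold elog
  split_ifs with h
  · simp [h]
  · rcases eq_or_ne y 0 with rfl | h0
    · simp
    · rw [ENNReal.log_pos_real h0 h]
      simp [EReal.toENNReal]

lemma continuous_eexp : Continuous eexp := by
  have : eexp = fun x : ℝ≥0∞ => EReal.exp (x : EReal) := funext eexp_eq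
  rw [this]
  exact ENNReal.continuous_exp.comp continuous_coe_ennreal_ereal

lemma continuous_elog : Continuous elog := by
  have : elog = fun x : ℝ≥0∞ => (ENNReal.log x).toENNReal := funext elog_eq
  rw [this]
  exact EReal.continuous_toENNReal.comp ENNReal.continuous_log

lemma one_le_eexp (x : ℝ≥0∞) : 1 ≤ eexp x := by
  rw [eexp_eq, EReal.one_le_exp_iff]; exact EReal.coe_ennreal_nonneg x

lemma eexp_le_eexp {x y : ℝ≥0∞} : eexp x ≤ eexp y ↔ x ≤ y := by
  rw [eexp_eq, eexp_eq, EReal.exp_le_exp_iff, EReal.coe_ennreal_le_coe_ennreal_iff]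

lemma eexp_add (x y : ℝ≥0∞) : eexp (x + y) = eexp x * eexp y := by
  simp only [eexp_eq, EReal.coe_ennreal_add, EReal.exp_add]

lemma eexp_elog {y : ℝ≥0∞} (h : 1 ≤ y) : eexp (elog y) = y := by
  rw [eexp_eq, elog_eq, EReal.coe_toENNReal, ENNReal.exp_log]
  rw [← ENNReal.log_one]
  exact ENNReal.log_monotone h

lemma eexp_ofReal {x : ℝ} (h : 0 ≤ x) :
    eexp (ENNReal.ofReal x) = ENNReal.ofReal (Real.exp x) := by
  simp [eexp, ENNReal.toReal_ofReal h]

variable {d : ℕ} {Ω : Type*} [MeasurableSpace Ω]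
    {P : Fin d → Measure Ω} {X : ℕ → Ω → Fin d → ℕ}

lemma meas_integrand (hmeas : ∀ n, Measurable (X n)) (n : ℕ) (q : Fin d → ℝ≥0∞) :
    Measurable (fun ω => ∏ j, (q j) ^ (X n ω j)) := by
  refine Finset.measurable_prod _ fun j _ => ?_
  have h1 : Measurable (fun m : ℕ => (q j) ^ m) := measurable_from_top
  exact h1.comp ((measurable_pi_apply j).comp (hmeas n))

lemma genFun_mono (n : ℕ) {q r : Fin d → ℝ≥0∞} (h : q ≤ r) :
    genFun P X n q ≤ genFun P X n r := by
  intro k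
  refine lintegral_mono fun ω => ?_
  exact Finset.prod_le_prod' fun j _ => pow_le_pow_left' (h j) _

lemma genFun_one (hprob : ∀ k, IsProbabilityMeasure (P k)) (n : ℕ) (k) :
    genFun P X n (fun _ => 1) k = 1 := by
  have := hprob k
  simp [genFun]

lemma one_le_genFun (hprob : ∀ k, IsProbabilityMeasure (P k)) (n : ℕ) {q : Fin d → ℝ≥0∞}
    (h : ∀ j, 1 ≤ q j) (k) : 1 ≤ genFun P X n q k := by
  rw [← genFun_one (X := X) hprob n k]
  exact genFun_mono n h k

lemma lower (hmeas : ∀ n, Measurable (X n)) (n : ℕ) (q : Fin d → ℝ≥0∞) (k) (a : ℝ≥0∞)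
    (E : Set Ω) (h : ∀ ω ∈ E, a ≤ ∏ j, (q j) ^ (X n ω j)) :
    P k E * a ≤ genFun P X n q k := by
  refine le_trans ?_ (mul_meas_ge_le_lintegral (meas_integrand hmeas n q) a)
  rw [mul_comm]
  gcongr
  exact h

lemma eexp_logGenFun (hprob : ∀ k, IsProbabilityMeasure (P k)) (n : ℕ) (l : Fin d → ℝ≥0∞) (k) :
    eexp (logGenFun P X n l k) = genFun P X n (fun j => eexp (l j)) k :=
  eexp_elog (one_le_genFun hprob n (fun j => one_le_eexp _) k)

lemma eexp_iter (hprob : ∀ k, IsProbabilityMeasure (P k))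
    (hiter : ∀ n q, (genFun P X 1)^[n] q = genFun P X n q) (n : ℕ) (l : Fin d → ℝ≥0∞) (k) :
    eexp ((logGenFun P X 1)^[n] l k) = genFun P X n (fun j => eexp (l j)) k := by
  have hs : Function.Semiconj (fun (l : Fin d → ℝ≥0∞) j => eexp (l j))
      (logGenFun P X 1) (genFun P X 1) := by
    intro l
    funext k
    exact eexp_logGenFun hprob 1 l k
  have := congrFun ((hs.iterate_right n) l) k
  simp only [hiter] at this
  exact this

lemma continuous_g (hprob : ∀ k, IsProbabilityMeasure (P k)) (hcont : GenFunContinuous P X) :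
    Continuous (logGenFun P X 1) := by
  refine continuous_pi fun k => continuous_elog.comp ?_
  refine (hcont k).comp_continuous (continuous_pi fun j => continuous_eexp.comp (continuous_apply j)) ?_
  intro l j
  exact lt_of_lt_of_le one_pos (one_le_eexp _)

lemma g_mono (hprob : ∀ k, IsProbabilityMeasure (P k)) : Monotone (logGenFun P X 1) := by
  intro l m h k
  rw [← eexp_le_eexp, eexp_logGenFun hprob, eexp_logGenFun hprob]
  exact genFun_mono 1 (fun j => eexp_le_eexp.2 (h j)) k

lemma basinZero_shift (n : ℕ) (l : Fin d → ℝ≥0∞) :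
    (logGenFun P X 1)^[n] l ∈ basinZero P X ↔ l ∈ basinZero P X := by
  simp only [basinZero, Set.mem_ofPred_eq, ← Function.iterate_add_apply]
  exact tendsto_add_atTop_iff_nat (f := fun m => (logGenFun P X 1)^[m] l) n

lemma basinInfty_shift (n : ℕ) (l : Fin d → ℝ≥0∞) :
    (logGenFun P X 1)^[n] l ∈ basinInfty P X ↔ l ∈ basinInfty P X := by
  simp only [basinInfty, Set.mem_ofPred_eq, ← Function.iterate_add_apply]
  rw [Filter.limsup_nat_add (fun m => ∑ k, (logGenFun P X 1)^[m] l k) n]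

lemma basins_disjoint : Disjoint (basinZero P X) (basinInfty P X) := by
  rw [Set.disjoint_left]
  intro l h0 hi
  simp only [basinZero, basinInfty, Set.mem_ofPred_eq] at h0 hi
  have : Tendsto (fun n => ∑ k, (logGenFun P X 1)^[n] l k) atTop (nhds (∑ k : Fin d, 0)) :=
    tendsto_finsetSum _ fun k _ => (tendsto_pi_nhds.1 h0) k
  rw [this.limsup_eq] at hi
  simp at hi

lemma single_le (q : Fin d → ℝ≥0∞) (h : ∀ j, 1 ≤ q j) (x : Fin d → ℕ) (j) (hx : 1 ≤ x j) :
    q j ≤ ∏ i, q i ^ x i := by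
  calc q j = q j ^ 1 := (pow_one _).symm
    _ ≤ q j ^ x j := pow_le_pow_right₀ (h j) hx
    _ ≤ _ := Finset.single_le_prod' (f := fun i => q i ^ x i)
        (fun i _ => one_le_pow₀ (h i)) (Finset.mem_univ j)

lemma sq_le (q : Fin d → ℝ≥0∞) (a : ℝ≥0∞) (h1 : ∀ j, 1 ≤ q j) (h : ∀ j, a ≤ q j) (x : Fin d → ℕ)
    (hx : 2 ≤ ∑ j, x j) : a ^ 2 ≤ ∏ i, q i ^ x i := by
  have h2 : max a 1 ^ 2 ≤ ∏ i, q i ^ x i := by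
    calc max a 1 ^ 2 ≤ max a 1 ^ (∑ j, x j) := pow_le_pow_right₀ (le_max_right _ _) hx
      _ = ∏ i, max a 1 ^ x i := (Finset.prod_pow_eq_pow_sum _ _ _).symm
      _ ≤ _ := Finset.prod_le_prod' fun j _ => pow_le_pow_left' (max_le (h j) (h1 j)) _
  exact le_trans (pow_le_pow_left' (le_max_left _ _) _) h2

lemma growth (hprob : ∀ k, IsProbabilityMeasure (P k)) (hmeas : ∀ n, Measurable (X n))
    (hiter : ∀ n q, (genFun P X 1)^[n] q = genFun P X n q)
    (hPR : PositiveRegular P X) (hNS : NonSingular P X) :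
    ∃ L : ℕ, 1 ≤ L ∧ ∃ c : ℝ≥0∞, c ≠ 0 ∧ c ≠ ⊤ ∧ ∀ q : Fin d → ℝ≥0∞, (∀ j, 1 ≤ q j) →
      ∀ k j, c * q j ^ 2 ≤ genFun P X L q k := by
  obtain ⟨N, hN⟩ := hPR
  obtain ⟨k0, hk0⟩ := hNS
  have hne : (Finset.univ : Finset (Fin d × Fin d)).Nonempty := ⟨(k0, k0), Finset.mem_univ _⟩
  obtain ⟨p, -, hp⟩ := Finset.exists_min_image Finset.univ
    (fun p : Fin d × Fin d => P p.1 {ω | 1 ≤ X N ω p.2}) hne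
  set c := P p.1 {ω | 1 ≤ X N ω p.2} with hc
  have hc0 : c ≠ 0 := (hN _ _).ne'
  have hct : c ≠ ⊤ := by have := hprob p.1; exact measure_ne_top _ _
  have hA : ∀ q : Fin d → ℝ≥0∞, (∀ j, 1 ≤ q j) → ∀ k j, c * q j ≤ genFun P X N q k := by
    intro q hq k j
    refine le_trans (mul_le_mul_left (hp (k, j) (Finset.mem_univ _)) _) ?_
    exact lower hmeas N q k (q j) _ fun ω hω => single_le q hq _ j hω
  set b := P k0 {ω | 2 ≤ ∑ j, X 1 ω j} with hb
  have hbt : b ≠ ⊤ := by have := hprob k0; exact measure_ne_top _ _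
  have hB : ∀ (q : Fin d → ℝ≥0∞) a, (∀ j, 1 ≤ q j) → (∀ j, a ≤ q j) →
      b * a ^ 2 ≤ genFun P X 1 q k0 := by
    intro q a hq ha
    exact lower hmeas 1 q k0 _ _ fun ω hω => sq_le q a hq ha _ hω
  have hcomp : ∀ m n q, genFun P X (m + n) q = genFun P X m (genFun P X n q) := by
    intro m n q
    rw [← hiter, ← hiter, ← hiter, Function.iterate_add_apply]
  refine ⟨N + (1 + N), by omega, c * (b * c ^ 2), ?_, ?_, ?_⟩
  · exact mul_ne_zero hc0 (mul_ne_zero hk0.ne' (pow_ne_zero _ hc0))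
  · exact ENNReal.mul_ne_top hct (ENNReal.mul_ne_top hbt (ENNReal.pow_ne_top hct))
  · intro q hq k j
    rw [hcomp]
    refine le_trans ?_ (hA _ (one_le_genFun hprob _ hq) k k0)
    rw [mul_assoc, hcomp, mul_assoc, ← mul_pow]
    gcongr
    exact hB _ _ (one_le_genFun hprob _ hq) fun i => hA q hq i j

lemma escape (hprob : ∀ k, IsProbabilityMeasure (P k)) (hmeas : ∀ n, Measurable (X n))
    (hiter : ∀ n q, (genFun P X 1)^[n] q = genFun P X n q)
    (hPR : PositiveRegular P X) (hNS : NonSingular P X) :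
    ∃ R : ℝ≥0∞, R ≠ ⊤ ∧ ∀ l : Fin d → ℝ≥0∞, ∀ j, R < l j → l ∈ basinInfty P X := by
  obtain ⟨L, hL, c, hc0, hct, hc⟩ := growth hprob hmeas hiter hPR hNS
  have hex : ∃ R : ℝ≥0∞, R ≠ ⊤ ∧ eexp 1 ≤ c * eexp R := by
    have hcr : 0 < c.toReal := ENNReal.toReal_pos hc0 hct
    refine ⟨ENNReal.ofReal (max 0 (Real.log (Real.exp 1 / c.toReal))), ENNReal.ofReal_ne_top, ?_⟩
    rw [eexp_ofReal (le_max_left _ _), ← ENNReal.ofReal_one, eexp_ofReal zero_le_one]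
    have hce : c * ENNReal.ofReal (Real.exp (max 0 (Real.log (Real.exp 1 / c.toReal)))) =
        ENNReal.ofReal (c.toReal * Real.exp (max 0 (Real.log (Real.exp 1 / c.toReal)))) := by
      rw [ENNReal.ofReal_mul hcr.le, ENNReal.ofReal_toReal hct]
    rw [hce]
    apply ENNReal.ofReal_le_ofReal
    have h1 : Real.exp 1 / c.toReal ≤ Real.exp (max 0 (Real.log (Real.exp 1 / c.toReal))) := by
      calc Real.exp 1 / c.toReal = Real.exp (Real.log (Real.exp 1 / c.toReal)) :=
            (Real.exp_log (by positivity)).symm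
        _ ≤ _ := Real.exp_le_exp.2 (le_max_right _ _)
    rw [div_le_iff₀ hcr] at h1
    linarith
  obtain ⟨R, hRt, hR⟩ := hex
  have step : ∀ l : Fin d → ℝ≥0∞, ∀ j, R ≤ l j → ∀ k, l j + 1 ≤ (logGenFun P X 1)^[L] l k := by
    intro l j hj k
    rw [← eexp_le_eexp, eexp_iter hprob hiter, eexp_add]
    refine le_trans ?_ (hc _ (fun i => one_le_eexp _) k j)
    calc eexp (l j) * eexp 1 ≤ eexp (l j) * (c * eexp (l j)) := by
          gcongr
          exact hR.trans (by gcongr; exact eexp_le_eexp.2 hj)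
      _ = _ := by ring
  refine ⟨R, hRt, fun l j hj => ?_⟩
  have hm : ∀ m : ℕ, l j + m ≤ (logGenFun P X 1)^[L * m] l j := by
    intro m
    induction m with
    | zero => simp
    | succ m ih =>
      have e : L * (m + 1) = L + L * m := by ring
      rw [e, Function.iterate_add_apply]
      refine le_trans ?_ (step _ j ((hj.le.trans le_self_add).trans ih) j)
      push_cast
      rw [← add_assoc]
      gcongr
  simp only [basinInfty, Set.mem_ofPred_eq]
  refine ENNReal.eq_top_of_forall_nnreal_le fun r => ?_
  apply le_limsup_of_frequently_le'
  rw [frequently_atTop]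
  intro a
  obtain ⟨m, hmr⟩ := exists_nat_ge r
  refine ⟨L * (max m a), ?_, ?_⟩
  · nlinarith [le_max_right m a]
  · calc (r : ℝ≥0∞) ≤ (m : ℝ≥0∞) := by exact_mod_cast hmr
      _ ≤ ((max m a : ℕ) : ℝ≥0∞) := by exact_mod_cast le_max_left m a
      _ ≤ l j + ((max m a : ℕ) : ℝ≥0∞) := le_add_self
      _ ≤ _ := hm _
      _ ≤ _ := Finset.single_le_sum (f := fun k => (logGenFun P X 1)^[L * (max m a)] l k)
          (fun _ _ => zero_le) (Finset.mem_univ j)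

lemma isOpen_basinInfty (hprob : ∀ k, IsProbabilityMeasure (P k)) (hmeas : ∀ n, Measurable (X n))
    (hiter : ∀ n q, (genFun P X 1)^[n] q = genFun P X n q)
    (hPR : PositiveRegular P X) (hNS : NonSingular P X) (hcont : GenFunContinuous P X) :
    IsOpen (basinInfty P X) := by
  obtain ⟨R, hRt, hR⟩ := escape hprob hmeas hiter hPR hNS
  have : basinInfty P X = ⋃ n : ℕ, ⋃ j : Fin d, {l | R < (logGenFun P X 1)^[n] l j} := by
    ext l
    simp only [Set.mem_iUnion, Set.mem_ofPred_eq]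
    constructor
    · intro h
      simp only [basinInfty, Set.mem_ofPred_eq] at h
      have h1 : (d : ℝ≥0∞) * R < limsup (fun n => ∑ k, (logGenFun P X 1)^[n] l k) atTop := by
        rw [h]
        exact (ENNReal.mul_ne_top (ENNReal.natCast_ne_top d) hRt).lt_top
      obtain ⟨n, hn⟩ := (frequently_lt_of_lt_limsup (by isBoundedDefault) h1).exists
      by_contra! hcon
      refine absurd hn (not_lt.2 ?_)
      calc ∑ k, (logGenFun P X 1)^[n] l k ≤ ∑ k : Fin d, R := Finset.sum_le_sum fun k _ => hcon n k
        _ = _ := by simp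
    · rintro ⟨n, j, h⟩
      exact (basinInfty_shift n l).1 (hR _ j h)
  rw [this]
  refine isOpen_iUnion fun n => isOpen_iUnion fun j => ?_
  exact isOpen_lt continuous_const
    ((continuous_apply j).comp ((continuous_g hprob hcont).iterate n))

attribute [local instance] Matrix.linftyOpNormedRing Matrix.linftyOpNormedAlgebra

lemma exists_vec (M : Matrix (Fin d) (Fin d) ℝ) (hM : ∀ i j, 0 ≤ M i j)
    (hs : ∀ μ ∈ spectrum ℂ (M.map (Complex.ofReal)), ‖μ‖ < 1) :
    ∃ v : Fin d → ℝ, (∀ i, 0 < v i) ∧ ∀ i, (M.mulVec v) i < v i := by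
  rcases Nat.eq_zero_or_pos d with rfl | hd
  · exact ⟨fun _ => 1, fun i => i.elim0, fun i => i.elim0⟩
  have : Nonempty (Fin d) := ⟨⟨0, hd⟩⟩
  set A : Matrix (Fin d) (Fin d) ℂ := M.map (Complex.ofReal) with hA
  have hr : spectralRadius ℂ A < (1 : NNReal) := by
    refine spectrum.spectralRadius_lt_of_forall_lt A fun z hz => ?_
    exact_mod_cast hs z hz
  have hev := (spectrum.pow_nnnorm_pow_one_div_tendsto_nhds_spectralRadius A).eventually_lt_const hr
  obtain ⟨N, hN, hN1⟩ := (hev.and (eventually_ge_atTop 1)).exists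
  have hnorm : ‖A ^ N‖ < 1 := by
    have hNpos : (0 : ℝ) < 1 / N := by positivity
    by_contra! hcon
    refine absurd hN (not_lt.2 ?_)
    have h1 : (1 : ℝ≥0∞) ≤ (‖A ^ N‖₊ : ℝ≥0∞) := by exact_mod_cast hcon
    simpa using ENNReal.one_le_rpow h1 hNpos
  set u : ℕ → Fin d → ℝ := fun n => (M ^ n).mulVec 1 with hu
  have hu0 : u 0 = 1 := by simp [hu]
  have husucc : ∀ n, u (n + 1) = M.mulVec (u n) := by
    intro n
    simp only [hu, Matrix.mulVec_mulVec, pow_succ']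
  have hunn : ∀ n i, 0 ≤ u n i := by
    intro n
    induction n with
    | zero => intro i; simp [hu0]
    | succ n ih =>
      intro i
      rw [husucc]
      simp only [Matrix.mulVec, dotProduct]
      exact Finset.sum_nonneg fun j _ => mul_nonneg (hM i j) (ih j)
  have huN : ∀ i, u N i < 1 := by
    intro i
    have e : ((A ^ N).mulVec 1) i = ((u N i : ℝ) : ℂ) := by
      have : A ^ N = (M ^ N).map Complex.ofReal := by
        rw [hA]
        exact (Matrix.map_pow M Complex.ofRealHom N).symm
      rw [this]
      simp [hu, Matrix.mulVec, dotProduct]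
    have h2 : ‖((A ^ N).mulVec 1) i‖ ≤ ‖A ^ N‖ * ‖(1 : Fin d → ℂ)‖ :=
      (norm_le_pi_norm _ i).trans (Matrix.linfty_opNorm_mulVec _ _)
    rw [e, norm_one, mul_one, Complex.norm_real] at h2
    exact lt_of_le_of_lt ((le_abs_self _).trans h2) hnorm
  refine ⟨∑ n ∈ Finset.range N, u n, fun i => ?_, fun i => ?_⟩
  · rw [Finset.sum_apply]
    have : u 0 i ≤ ∑ n ∈ Finset.range N, u n i :=
      Finset.single_le_sum (f := fun n => u n i) (fun n _ => hunn n i)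
        (Finset.mem_range.2 (by omega))
    rw [hu0] at this
    exact lt_of_lt_of_le one_pos this
  · have h3 : M.mulVec (∑ n ∈ Finset.range N, u n) = ∑ n ∈ Finset.range N, u (n + 1) := by
      rw [Matrix.mulVec_sum]
      simp only [husucc]
    have h4 : (∑ n ∈ Finset.range N, u (n + 1)) + u 0 = (∑ n ∈ Finset.range N, u n) + u N := by
      rw [← Finset.sum_range_succ', Finset.sum_range_succ]
    have h5 := congrFun h4 i
    rw [h3]
    simp only [Pi.add_apply, hu0, Pi.one_apply] at h5
    have := huN i
    linarith

lemma local_contr (hprob : ∀ k, IsProbabilityMeasure (P k)) (hmeas : ∀ n, Measurable (X n))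
    (hsub : Subcritical P X) (hcont : GenFunContinuous P X) :
    ∃ v : Fin d → ℝ, (∀ i, 0 < v i) ∧ ∃ θ : ℝ, 0 < θ ∧ θ < 1 ∧ ∃ t₁ : ℝ, 0 < t₁ ∧
      ∀ t, 0 < t → t < t₁ → ∀ k, logGenFun P X 1 (fun j => ENNReal.ofReal (t * v j)) k
        ≤ ENNReal.ofReal (θ * t * v k) := by
  obtain ⟨v, hv, hMv⟩ := exists_vec (meanMatrix P X) (fun i j => ENNReal.toReal_nonneg) hsub.2
  refine ⟨v, hv, ?_⟩
  have hθ : ∀ᶠ θ : ℝ in nhdsWithin 1 (Set.Iio 1),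
      ∀ k, ((meanMatrix P X).mulVec v) k < θ * v k := by
    rw [eventually_all]
    intro k
    have : Tendsto (fun θ : ℝ => θ * v k) (nhdsWithin 1 (Set.Iio 1)) (nhds (1 * v k)) :=
      ((continuous_id.mul continuous_const).tendsto' _ _ rfl).mono_left nhdsWithin_le_nhds
    exact this.eventually_const_lt (by simpa using hMv k)
  have hθ0 : ∀ᶠ θ : ℝ in nhdsWithin 1 (Set.Iio 1), 0 < θ :=
    nhdsWithin_le_nhds (lt_mem_nhds one_pos)
  obtain ⟨θ, ⟨hθk, hθpos⟩, hθ1⟩ := ((hθ.and hθ0).and self_mem_nhdsWithin).exists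
  refine ⟨θ, hθpos, hθ1, ?_⟩
  set S : Ω → ℝ := fun ω => ∑ j, v j * (X 1 ω j : ℝ) with hS
  have hXm : ∀ j, Measurable (fun ω => X 1 ω j) := fun j => (measurable_pi_apply j).comp (hmeas 1)
  have hXr : ∀ j, Measurable (fun ω => (X 1 ω j : ℝ)) := fun j =>
    (measurable_from_top (f := fun n : ℕ => (n : ℝ))).comp (hXm j)
  have hSm : Measurable S := Finset.measurable_sum _ fun j _ => (hXr j).const_mul (v j)
  have hgen : ∀ t k, genFun P X 1 (fun j => ENNReal.ofReal (Real.exp (t * v j))) k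
      = ∫⁻ ω, ENNReal.ofReal (Real.exp (t * S ω)) ∂(P k) := by
    intro t k
    refine lintegral_congr fun ω => ?_
    rw [hS, Finset.mul_sum, Real.exp_sum, ENNReal.ofReal_prod_of_nonneg
      (fun _ _ => (Real.exp_pos _).le)]
    refine Finset.prod_congr rfl fun j _ => ?_
    rw [← ENNReal.ofReal_pow (Real.exp_pos _).le, ← Real.exp_nat_mul]
    congr 2; ring
  have hint : ∀ k, ∀ᶠ t : ℝ in nhds 0, Integrable (fun ω => Real.exp (t * S ω)) (P k) := by
    intro k
    have hca : ContinuousAt (fun q => genFun P X 1 q k) (fun _ => 1) := by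
      refine (hcont k).continuousAt ?_
      have ho : IsOpen {q : Fin d → ℝ≥0∞ | ∀ j, 0 < q j} := by
        have : {q : Fin d → ℝ≥0∞ | ∀ j, 0 < q j} = ⋂ j, {q | 0 < q j} := by
          ext; simp
        rw [this]
        exact isOpen_iInter_of_finite fun j => isOpen_lt continuous_const (continuous_apply j)
      exact ho.mem_nhds (fun j => one_pos)
    have hpath : Tendsto (fun (t : ℝ) (j : Fin d) => ENNReal.ofReal (Real.exp (t * v j))) (nhds 0)
        (nhds (fun _ => 1)) := by
      rw [tendsto_pi_nhds]
      intro j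
      have : Continuous fun t : ℝ => ENNReal.ofReal (Real.exp (t * v j)) :=
        ENNReal.continuous_ofReal.comp (by fun_prop)
      exact this.tendsto' _ _ (by simp)
    have h1 := hca.tendsto.comp hpath
    have h2 : genFun P X 1 (fun _ => 1) k < ⊤ := by
      rw [genFun_one hprob]; exact ENNReal.one_lt_top
    filter_upwards [h1.eventually_lt_const h2] with t ht
    simp only [Function.comp_apply, hgen] at ht
    refine ⟨(Real.measurable_exp.comp (hSm.const_mul t)).aestronglyMeasurable, ?_⟩
    rw [hasFiniteIntegral_iff_ofReal (ae_of_all _ fun ω => (Real.exp_pos _).le)]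
    exact ht
  have hmean : ∀ k, ∫ ω, S ω ∂(P k) = ((meanMatrix P X).mulVec v) k := by
    intro k
    have hXi : ∀ j, Integrable (fun ω => (X 1 ω j : ℝ)) (P k) := by
      intro j
      refine ⟨(hXr j).aestronglyMeasurable, ?_⟩
      rw [hasFiniteIntegral_iff_ofReal (ae_of_all _ fun ω => Nat.cast_nonneg _)]
      simpa using (hsub.1 k j).lt_top
    rw [hS, integral_finsetSum _ fun j _ => (hXi j).const_mul _]
    refine Finset.sum_congr rfl fun j _ => ?_
    rw [integral_const_mul, integral_eq_lintegral_of_nonneg_ae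
      (ae_of_all _ fun ω => Nat.cast_nonneg _) (hXr j).aestronglyMeasurable, mul_comm]
    simp [meanMatrix]
  have hev : ∀ᶠ t : ℝ in nhdsWithin 0 (Set.Ioi 0), ∀ k,
      logGenFun P X 1 (fun j => ENNReal.ofReal (t * v j)) k ≤ ENNReal.ofReal (θ * t * v k) := by
    rw [eventually_all]
    intro k
    have := hprob k
    have h0 : (0 : ℝ) ∈ interior (integrableExpSet S (P k)) :=
      mem_interior_iff_mem_nhds.2 (hint k)
    have hd := hasDerivAt_mgf h0
    simp only [zero_mul, Real.exp_zero, mul_one, hmean] at hd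
    have hsl := hd.tendsto_slope_zero_right.eventually_lt_const (hθk k)
    filter_upwards [hsl, self_mem_nhdsWithin, nhdsWithin_le_nhds (hint k)] with t h1 h2 h3
    have h2' : 0 < t := h2
    rw [← eexp_le_eexp, eexp_logGenFun hprob,
      eexp_ofReal (by have := hv k; positivity)]
    have e : (fun j => eexp (ENNReal.ofReal (t * v j)))
        = fun j => ENNReal.ofReal (Real.exp (t * v j)) :=
      funext fun j => eexp_ofReal (by have := hv j; positivity)
    rw [e, hgen, ← ofReal_integral_eq_lintegral_ofReal h3 (ae_of_all _ fun ω => (Real.exp_pos _).le)]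
    apply ENNReal.ofReal_le_ofReal
    simp only [zero_add, mgf_zero, smul_eq_mul] at h1
    rw [inv_mul_lt_iff₀ h2'] at h1
    have h4 : mgf S (P k) t = ∫ ω, Real.exp (t * S ω) ∂(P k) := rfl
    rw [← h4]
    have h5 := Real.add_one_le_exp (θ * t * v k)
    nlinarith
  obtain ⟨t₁, ht₁, H⟩ := mem_nhdsGT_iff_exists_Ioo_subset.1 hev
  exact ⟨t₁, ht₁, fun t h1 h2 => H ⟨h1, h2⟩⟩

lemma isOpen_basinZero (hprob : ∀ k, IsProbabilityMeasure (P k)) (hmeas : ∀ n, Measurable (X n))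
    (hsub : Subcritical P X) (hcont : GenFunContinuous P X) :
    IsOpen (basinZero P X) := by
  obtain ⟨v, hv, θ, hθ0, hθ1, t₁, ht₁, H⟩ := local_contr hprob hmeas hsub hcont
  set t := t₁ / 2 with ht
  have ht0 : 0 < t := by positivity
  have htt : t < t₁ := by linarith
  set w : Fin d → ℝ≥0∞ := fun j => ENNReal.ofReal (t * v j)
  have hn : ∀ n : ℕ, ∀ k, (logGenFun P X 1)^[n] w k ≤ ENNReal.ofReal (θ ^ n * t * v k) := by
    intro n
    induction n with
    | zero => intro k; simp [w]
    | succ n ih =>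
      intro k
      rw [Function.iterate_succ_apply']
      have h1 : θ ^ n * t ≤ t := by
        have := pow_le_one₀ hθ0.le hθ1.le (n := n)
        nlinarith
      refine le_trans (g_mono hprob ih k) ?_
      refine le_trans (H (θ ^ n * t) (by positivity) (by linarith) k) (le_of_eq ?_)
      congr 1; ring
  have hU : ∀ l, (∀ j, l j < w j) → l ∈ basinZero P X := by
    intro l hl
    simp only [basinZero, Set.mem_ofPred_eq]
    rw [tendsto_pi_nhds]
    intro k
    have hlim : Tendsto (fun n : ℕ => ENNReal.ofReal (θ ^ n * t * v k)) atTop (nhds 0) := by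
      have : Tendsto (fun n : ℕ => θ ^ n * t * v k) atTop (nhds (0 * t * v k)) :=
        ((tendsto_pow_atTop_nhds_zero_of_lt_one hθ0.le hθ1).mul_const t).mul_const (v k)
      simpa using ENNReal.tendsto_ofReal this
    refine tendsto_of_tendsto_of_tendsto_of_le_of_le tendsto_const_nhds hlim
      (fun _ => zero_le) (fun n => ?_)
    exact le_trans ((g_mono hprob).iterate n (fun j => (hl j).le) k) (hn n k)
  have : basinZero P X = ⋃ n : ℕ, ⋂ j : Fin d, {l | (logGenFun P X 1)^[n] l j < w j} := by
    ext l
    simp only [Set.mem_iUnion, Set.mem_iInter, Set.mem_ofPred_eq]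
    constructor
    · intro h
      simp only [basinZero, Set.mem_ofPred_eq] at h
      have h1 : ∀ j, ∀ᶠ n in atTop, (logGenFun P X 1)^[n] l j < w j := by
        intro j
        refine ((tendsto_pi_nhds.1 h) j).eventually_lt_const ?_
        simp only [w, Pi.zero_apply, ENNReal.ofReal_pos]
        exact mul_pos ht0 (hv j)
      exact (eventually_all.2 h1).exists
    · rintro ⟨n, h⟩
      exact (basinZero_shift n l).1 (hU _ h)
  rw [this]
  refine isOpen_iUnion fun n => isOpen_iInter_of_finite fun j => ?_
  exact isOpen_lt ((continuous_apply j).comp ((continuous_g hprob hcont).iterate n))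
    continuous_const

end Basins

/-- Under the hypotheses of the main theorem, the basins
`S₀ = {λ ∈ [0,∞]^d : g⁽ⁿ⁾(λ) → 0}` and `S_∞ = {λ : limsup |g⁽ⁿ⁾(λ)| = ∞}` are open
subsets of `[0,∞]^d` (the `d`-fold product of the one-point compactification `ℝ≥0∞`),
they are disjoint, and both are invariant: `g(S) ⊆ S` and `g⁻¹(S) ⊆ S`. -/
theorem basins_open_disjoint_invariant
    {d : ℕ} {Ω : Type*} [MeasurableSpace Ω]
    (P : Fin d → Measure Ω) (X : ℕ → Ω → Fin d → ℕ)
    (hprob : ∀ k, IsProbabilityMeasure (P k))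
    (hmeas : ∀ n, Measurable (X n))
    (hiter : ∀ n q, (genFun P X 1)^[n] q = genFun P X n q)
    (hsub : Subcritical P X)
    (hPR : PositiveRegular P X)
    (hNS : NonSingular P X)
    (hcont : GenFunContinuous P X) :
    IsOpen (basinZero P X) ∧ IsOpen (basinInfty P X) ∧
      Disjoint (basinZero P X) (basinInfty P X) ∧
      logGenFun P X 1 '' basinZero P X ⊆ basinZero P X ∧
      logGenFun P X 1 '' basinInfty P X ⊆ basinInfty P X ∧
      logGenFun P X 1 ⁻¹' basinZero P X ⊆ basinZero P X ∧
      logGenFun P X 1 ⁻¹' basinInfty P X ⊆ basinInfty P X := by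
  refine ⟨Basins.isOpen_basinZero hprob hmeas hsub hcont,
    Basins.isOpen_basinInfty hprob hmeas hiter hPR hNS hcont, Basins.basins_disjoint, ?_, ?_, ?_, ?_⟩
  · rintro _ ⟨l, hl, rfl⟩
    exact (Basins.basinZero_shift 1 l).2 hl
  · rintro _ ⟨l, hl, rfl⟩
    exact (Basins.basinInfty_shift 1 l).2 hl
  · intro l hl
    exact (Basins.basinZero_shift 1 l).1 hl
  · intro l hl
    exact (Basins.basinInfty_shift 1 l).1 hl
end

section
/- Under the hypotheses of the main theorem, for every unit vector u ∈ [0,∞)^d there is exactly one r > 0 such that ru ∈ [0,∞)^d \ (S_0 ∪ S_∞). -/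
open MeasureTheory ProbabilityTheory ENNReal Filter Set

theorem eexp_eq (x : ℝ≥0∞) : eexp x = EReal.exp (x : EReal) := by
  unfold eexp
  split_ifs with h
  · simp [h]
  · lift x to NNReal using h
    simp
    rfl

theorem elog_eq (y : ℝ≥0∞) : elog y = (ENNReal.log y).toENNReal := by
  unfold elog
  split_ifs with h
  · simp [h]
  · rcases eq_or_ne y 0 with h0 | h0
    · simp [h0]
    · rw [ENNReal.log_pos_real h0 h]
      simp

theorem elog_eexp (x : ℝ≥0∞) : elog (eexp x) = x := by
  rw [eexp_eq, elog_eq]; simp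

theorem eexp_elog {y : ℝ≥0∞} (h : 1 ≤ y) : eexp (elog y) = y := by
  rw [eexp_eq, elog_eq, EReal.coe_toENNReal (by simpa using h)]; simp

theorem eexp_mono : Monotone eexp := by
  intro x y h
  rw [eexp_eq, eexp_eq]
  exact EReal.exp_monotone (by exact_mod_cast h)

theorem elog_mono : Monotone elog := by
  intro x y h
  rw [elog_eq, elog_eq]
  exact EReal.toENNReal_le_toENNReal (ENNReal.log_monotone h)

theorem one_le_eexp (x : ℝ≥0∞) : 1 ≤ eexp x := by
  rw [eexp_eq]; simp [EReal.coe_ennreal_nonneg]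

theorem one_lt_eexp {x : ℝ≥0∞} (h : 0 < x) : 1 < eexp x := by
  rw [eexp_eq]; simpa using h

theorem eexp_zero : eexp 0 = 1 := by
  rw [eexp_eq]; simp

theorem elog_one : elog 1 = 0 := by
  rw [elog_eq]; simp

theorem eexp_ne_top {x : ℝ≥0∞} (h : x ≠ ⊤) : eexp x ≠ ⊤ := by
  unfold eexp; simp [h]

theorem eexp_continuous : Continuous eexp := by
  have : eexp = fun x : ℝ≥0∞ => EReal.exp (x : EReal) := funext eexp_eq
  rw [this]
  exact ENNReal.continuous_exp.comp continuous_coe_ennreal_ereal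

theorem elog_continuous : Continuous elog :=
  elog_mono.continuous_of_surjective (fun x => ⟨eexp x, elog_eexp x⟩)

theorem eexp_add (x y : ℝ≥0∞) : eexp (x + y) = eexp x * eexp y := by
  rw [eexp_eq, eexp_eq, eexp_eq, EReal.coe_ennreal_add, EReal.exp_add]

theorem eexp_smul {s : ℝ≥0∞} (hs : s ≠ ⊤) (x : ℝ≥0∞) : eexp (s * x) = eexp x ^ s.toReal := by
  rw [eexp_eq, eexp_eq, ← EReal.exp_mul, EReal.coe_ennreal_mul, mul_comm]
  lift s to NNReal using hs
  rfl

theorem eexp_le_iff {x y : ℝ≥0∞} : eexp x ≤ eexp y ↔ x ≤ y := by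
  rw [eexp_eq, eexp_eq]; simp

section Main
variable {d : ℕ} {Ω : Type*} [MeasurableSpace Ω]
    {P : Fin d → Measure Ω} {X : ℕ → Ω → Fin d → ℕ}

theorem one_le_prod {q : Fin d → ℝ≥0∞} (hq : ∀ j, 1 ≤ q j) (x : Fin d → ℕ) :
    1 ≤ ∏ j, q j ^ x j :=
  Finset.one_le_prod' (fun j _ => one_le_pow_of_one_le' (hq j) _)

theorem one_le_genFun (hprob : ∀ k, IsProbabilityMeasure (P k)) (n : ℕ) {q : Fin d → ℝ≥0∞}
    (hq : ∀ j, 1 ≤ q j) (k : Fin d) : 1 ≤ genFun P X n q k := by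
  have := hprob k
  calc (1 : ℝ≥0∞) = ∫⁻ _, 1 ∂(P k) := by simp
    _ ≤ _ := lintegral_mono (fun _ => one_le_prod hq _)

theorem eexp_logGenFun (hprob : ∀ k, IsProbabilityMeasure (P k)) (n : ℕ) (l : Fin d → ℝ≥0∞)
    (k : Fin d) : eexp (logGenFun P X n l k) = genFun P X n (fun j => eexp (l j)) k :=
  eexp_elog (one_le_genFun hprob n (fun _ => one_le_eexp _) k)

theorem iter_eq (hprob : ∀ k, IsProbabilityMeasure (P k))
    (hiter : ∀ n q, (genFun P X 1)^[n] q = genFun P X n q) (n : ℕ) (l : Fin d → ℝ≥0∞) :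
    (logGenFun P X 1)^[n] l = logGenFun P X n l := by
  have hs : Function.Semiconj (fun (l : Fin d → ℝ≥0∞) j => eexp (l j)) (logGenFun P X 1)
      (genFun P X 1) := by
    intro l
    funext k
    exact eexp_logGenFun hprob 1 l k
  have := (hs.iterate_right n) l
  funext k
  have h2 := congrFun this k
  rw [hiter] at h2
  unfold logGenFun
  rw [← h2, elog_eexp]
  rfl

theorem genFun_mono (n : ℕ) {q q' : Fin d → ℝ≥0∞} (h : q ≤ q') (k : Fin d) :
    genFun P X n q k ≤ genFun P X n q' k :=
  lintegral_mono (fun ω => Finset.prod_le_prod' (fun j _ => pow_le_pow_left' (h j) _))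

theorem logGenFun_mono (n : ℕ) : Monotone (logGenFun P X n) := fun _ _ h k =>
  elog_mono (genFun_mono n (fun j => eexp_mono (h j)) k)

theorem meas_prod (hmeas : ∀ n, Measurable (X n)) (n : ℕ) (q : Fin d → ℝ≥0∞) :
    Measurable (fun ω => ∏ j, q j ^ X n ω j) :=
  (measurable_of_countable (fun x : Fin d → ℕ => ∏ j, q j ^ x j)).comp (hmeas n)

theorem prod_rpow_eq {s : ℝ} (hs : 0 ≤ s) (q : Fin d → ℝ≥0∞) (x : Fin d → ℕ) :
    ∏ j, (q j ^ s) ^ x j = (∏ j, q j ^ x j) ^ s := by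
  rw [← ENNReal.prod_rpow_of_nonneg hs]
  refine Finset.prod_congr rfl fun j _ => ?_
  rw [← ENNReal.rpow_natCast, ← ENNReal.rpow_natCast, ← ENNReal.rpow_mul, ← ENNReal.rpow_mul,
    mul_comm]

theorem scale_set (hmeas : ∀ n, Measurable (X n)) (n : ℕ) (μ : Measure Ω) {s : ℝ} (hs : 0 ≤ s)
    (hs1 : s ≤ 1) (q : Fin d → ℝ≥0∞) :
    ∫⁻ ω, ∏ j, (q j ^ s) ^ X n ω j ∂μ ≤
      (∫⁻ ω, ∏ j, q j ^ X n ω j ∂μ) ^ s * μ univ ^ (1 - s) := by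
  have := ENNReal.lintegral_mul_norm_pow_le (μ := μ) (f := fun ω => ∏ j, q j ^ X n ω j)
    (g := fun _ => 1) (p := s) (q := 1 - s) (meas_prod hmeas n q).aemeasurable
    aemeasurable_const hs (by linarith) (by ring)
  simpa [prod_rpow_eq hs] using this

theorem logGenFun_scale (hprob : ∀ k, IsProbabilityMeasure (P k)) (hmeas : ∀ n, Measurable (X n))
    (n : ℕ) {s : ℝ≥0∞} (hs : s ≤ 1) (l : Fin d → ℝ≥0∞) (k : Fin d) :
    logGenFun P X n (fun j => s * l j) k ≤ s * logGenFun P X n l k := by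
  have := hprob k
  have hst : s ≠ ⊤ := ne_top_of_le_ne_top one_ne_top hs
  rw [← eexp_le_iff, eexp_logGenFun hprob, eexp_smul hst, eexp_logGenFun hprob]
  simp only [eexp_smul hst]
  have := scale_set hmeas n (P k) (s := s.toReal) toReal_nonneg
    (by simpa using ENNReal.toReal_mono one_ne_top hs) (fun j => eexp (l j))
  simpa [genFun] using this

theorem logGenFun_continuous (hcont : GenFunContinuous P X) : Continuous (logGenFun P X 1) := by
  refine continuous_pi fun k => elog_continuous.comp ?_
  exact (hcont k).comp_continuous
    (continuous_pi fun j => eexp_continuous.comp (continuous_apply j))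
    (fun l j => lt_of_lt_of_le one_pos (one_le_eexp _))

section Mat
attribute [local instance] Matrix.linftyOpNormedRing Matrix.linftyOpNormedAlgebra

theorem exists_pos_vec [Nonempty (Fin d)] (M : Matrix (Fin d) (Fin d) ℝ) (hM : ∀ k j, 0 ≤ M k j)
    (hs : ∀ μ ∈ spectrum ℂ (M.map (Complex.ofReal)), ‖μ‖ < 1) :
    ∃ v : Fin d → ℝ, (∀ k, 0 < v k) ∧ ∀ k, (M.mulVec v) k < v k := by
  have hsr : spectralRadius ℂ (M.map (Complex.ofReal)) < ((1 : NNReal) : ℝ≥0∞) :=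
    spectrum.spectralRadius_lt_of_forall_lt _ (fun z hz => by exact_mod_cast hs z hz)
  have hev := ((spectrum.pow_nnnorm_pow_one_div_tendsto_nhds_spectralRadius
    (M.map (Complex.ofReal))).eventually_lt_const hsr).and (eventually_ge_atTop 1)
  obtain ⟨n, hn, hn1⟩ := hev.exists
  have hnorm : ‖(M.map (Complex.ofReal)) ^ n‖ < 1 := by
    by_contra hcon
    push Not at hcon
    have : (1 : ℝ≥0∞) ≤ (‖(M.map (Complex.ofReal)) ^ n‖₊ : ℝ≥0∞) := by exact_mod_cast hcon
    have h2 := ENNReal.one_le_rpow this (z := 1 / (n : ℝ)) (by positivity)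
    exact absurd hn (not_lt.2 (by simpa using h2))
  have hpow : (M.map (Complex.ofReal)) ^ n = (M ^ n).map (Complex.ofReal) :=
    (map_pow (RingHom.mapMatrix (m := Fin d) Complex.ofRealHom) M n).symm
  rw [hpow, Matrix.linfty_opNorm_def] at hnorm
  have hrow : ∀ k, ((M ^ n).mulVec 1) k < 1 := by
    intro k
    have h1 : (∑ j, ‖((M ^ n).map (Complex.ofReal)) k j‖₊) < 1 :=
      lt_of_le_of_lt (Finset.le_sup (f := fun i => ∑ j, ‖((M ^ n).map (Complex.ofReal)) i j‖₊)
        (Finset.mem_univ k)) (by exact_mod_cast hnorm)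
    have h2 : (∑ j, ‖((M ^ n).map (Complex.ofReal)) k j‖) < 1 := by
      have := NNReal.coe_lt_coe.2 h1
      simpa using this
    refine lt_of_le_of_lt ?_ h2
    simp only [Matrix.mulVec, dotProduct, Pi.one_apply, mul_one, Matrix.map_apply,
      Complex.norm_real]
    exact Finset.sum_le_sum fun j _ => le_abs_self _
  have hnn : ∀ i k, 0 ≤ ((M ^ i).mulVec 1) k := by
    intro i
    induction i with
    | zero => intro k; simp
    | succ i ih =>
      intro k
      rw [pow_succ', ← Matrix.mulVec_mulVec]
      simp only [Matrix.mulVec, dotProduct] at ih ⊢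
      exact Finset.sum_nonneg fun j _ => mul_nonneg (hM k j) (ih j)
  refine ⟨∑ i ∈ Finset.range n, (M ^ i).mulVec 1, fun k => ?_, fun k => ?_⟩
  · rw [Finset.sum_apply]
    have := Finset.single_le_sum (f := fun i => ((M ^ i).mulVec 1) k) (fun i _ => hnn i k)
      (Finset.mem_range.2 hn1)
    simp only [pow_zero, Matrix.one_mulVec, Pi.one_apply] at this
    linarith
  · have h1 : M.mulVec (∑ i ∈ Finset.range n, (M ^ i).mulVec 1) + 1
        = (∑ i ∈ Finset.range n, (M ^ i).mulVec 1) + (M ^ n).mulVec 1 := by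
      rw [← Finset.sum_range_succ (fun i => (M ^ i).mulVec 1), Finset.sum_range_succ',
        Matrix.mulVec_sum]
      simp [pow_succ', Matrix.mulVec_mulVec]
    have h2 := congrFun h1 k
    simp only [Pi.add_apply, Pi.one_apply] at h2
    linarith [hrow k]
end Mat

theorem prod_eexp (v : Fin d → ℝ) (hv : ∀ k, 0 < v k) {t : ℝ} (ht : 0 ≤ t) (x : Fin d → ℕ) :
    ∏ j, eexp (ENNReal.ofReal (t * v j)) ^ x j
      = ENNReal.ofReal (Real.exp (t * ∑ j, v j * x j)) := by
  rw [Finset.mul_sum, Real.exp_sum, ENNReal.ofReal_prod_of_nonneg (fun _ _ => (Real.exp_pos _).le)]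
  refine Finset.prod_congr rfl fun j _ => ?_
  have h0 : 0 ≤ t * v j := mul_nonneg ht (hv j).le
  rw [eexp, if_neg ofReal_ne_top, ENNReal.toReal_ofReal h0, ← ENNReal.ofReal_pow (Real.exp_pos _).le,
    ← Real.exp_nat_mul]
  congr 2
  ring

theorem local_bound (hprob : ∀ k, IsProbabilityMeasure (P k)) (hmeas : ∀ n, Measurable (X n))
    (hsub : Subcritical P X) (hcont : GenFunContinuous P X)
    (v : Fin d → ℝ) (hv : ∀ k, 0 < v k) (k : Fin d) (c : ℝ)
    (hc : ((meanMatrix P X).mulVec v) k < c * v k) :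
    ∀ᶠ t in nhdsWithin (0 : ℝ) (Ioi 0),
      logGenFun P X 1 (fun j => ENNReal.ofReal (t * v j)) k ≤ ENNReal.ofReal (t * (c * v k)) := by
  have := hprob k
  set Y : Ω → ℝ := fun ω => ∑ j, v j * (X 1 ω j : ℝ) with hY
  have hYm : Measurable Y :=
    (measurable_of_countable (fun x : Fin d → ℕ => ∑ j, v j * (x j : ℝ))).comp (hmeas 1)
  have hY0 : ∀ ω, 0 ≤ Y ω := fun ω =>
    Finset.sum_nonneg fun j _ => mul_nonneg (hv j).le (Nat.cast_nonneg _)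
  have htend : Tendsto (fun t : ℝ => genFun P X 1 (fun j => eexp (ENNReal.ofReal (t * v j))) k)
      (nhds 0) (nhds 1) := by
    have hc1 : Continuous (fun t : ℝ =>
        genFun P X 1 (fun j => eexp (ENNReal.ofReal (t * v j))) k) :=
      (hcont k).comp_continuous
        (continuous_pi fun j => eexp_continuous.comp (ENNReal.continuous_ofReal.comp
          (continuous_id.mul continuous_const)))
        (fun l j => lt_of_lt_of_le one_pos (one_le_eexp _))
    have := hc1.tendsto 0
    simpa [eexp_zero, genFun] using this
  have hfin : ∀ᶠ t in nhds (0 : ℝ), t ∈ integrableExpSet Y (P k) := by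
    filter_upwards [htend.eventually_lt_const one_lt_top] with t ht
    refine ⟨(Real.measurable_exp.comp (hYm.const_mul t)).aestronglyMeasurable, ?_⟩
    rw [hasFiniteIntegral_iff_ofReal (Eventually.of_forall fun ω => (Real.exp_pos _).le)]
    refine lt_of_le_of_lt (lintegral_mono fun ω => ?_) ht
    rcases le_total 0 t with h0 | h0
    · exact (prod_eexp v hv h0 (X 1 ω)).ge
    · refine le_trans ?_ (one_le_prod (fun _ => one_le_eexp _) _)
      rw [ENNReal.ofReal_le_one, Real.exp_le_one_iff]
      exact mul_nonpos_of_nonpos_of_nonneg h0 (hY0 ω)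
  have hint : 0 ∈ interior (integrableExpSet Y (P k)) := mem_interior_iff_mem_nhds.2 hfin
  have hder : HasDerivAt (cgf Y (P k)) (∫ ω, Y ω ∂(P k)) 0 := by
    have h1 := (analyticAt_cgf hint).differentiableAt.hasDerivAt
    rw [deriv_cgf_zero hint] at h1
    simpa using h1
  have hmean : ∫ ω, Y ω ∂(P k) = ((meanMatrix P X).mulVec v) k := by
    have hXm : ∀ j, Measurable (fun ω => (X 1 ω j : ℝ≥0∞)) := fun j =>
      (measurable_of_countable (fun x : Fin d → ℕ => (x j : ℝ≥0∞))).comp (hmeas 1)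
    have hXi : ∀ j, Integrable (fun ω => (X 1 ω j : ℝ)) (P k) := fun j => by
      simpa using integrable_toReal_of_lintegral_ne_top (hXm j).aemeasurable (hsub.1 k j)
    rw [hY, integral_finsetSum _ (fun j _ => (hXi j).const_mul _)]
    refine Finset.sum_congr rfl fun j _ => ?_
    rw [integral_const_mul, mul_comm]
    show _ = (∫⁻ ω, (X 1 ω j : ℝ≥0∞) ∂(P k)).toReal * v j
    congr 1
    have := integral_toReal (μ := P k) (hXm j).aemeasurable (by simp)
    simpa using this
  rw [hmean] at hder
  have hslope := (hasDerivAt_iff_tendsto_slope.1 hder).mono_left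
    (nhdsWithin_mono 0 (fun t (ht : (0 : ℝ) < t) => ht.ne'))
  filter_upwards [hslope.eventually_lt_const hc, self_mem_nhdsWithin,
    hfin.filter_mono nhdsWithin_le_nhds] with t h1 (h2 : 0 < t) h3
  have hg : genFun P X 1 (fun j => eexp (ENNReal.ofReal (t * v j))) k
      = ENNReal.ofReal (Real.exp (cgf Y (P k) t)) := by
    rw [exp_cgf h3, mgf, ofReal_integral_eq_lintegral_ofReal h3
      (Eventually.of_forall fun ω => (Real.exp_pos _).le)]
    exact lintegral_congr fun ω => prod_eexp v hv h2.le (X 1 ω)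
  rw [slope_def_field, cgf_zero, sub_zero, sub_zero, div_lt_iff₀ h2] at h1
  rw [logGenFun, hg, elog, if_neg ofReal_ne_top, ENNReal.toReal_ofReal (Real.exp_pos _).le,
    Real.log_exp]
  exact ENNReal.ofReal_le_ofReal (by linarith)

theorem attract (hd : Nonempty (Fin d))
    (hprob : ∀ k, IsProbabilityMeasure (P k)) (hmeas : ∀ n, Measurable (X n))
    (hsub : Subcritical P X) (hcont : GenFunContinuous P X) :
    ∃ w : Fin d → ℝ≥0∞, (∀ k, 0 < w k) ∧
      Tendsto (fun n => (logGenFun P X 1)^[n] w) atTop (nhds 0) := by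
  obtain ⟨v, hv, hMv⟩ := exists_pos_vec (meanMatrix P X) (fun k j => toReal_nonneg) hsub.2
  obtain ⟨c, hc, hc0, hc1⟩ : ∃ c : ℝ, (∀ k, ((meanMatrix P X).mulVec v) k < c * v k) ∧
      0 < c ∧ c < 1 := by
    have h1 : ∀ᶠ c in nhdsWithin (1 : ℝ) (Iio 1),
        ∀ k, ((meanMatrix P X).mulVec v) k < c * v k := by
      refine Filter.Eventually.filter_mono nhdsWithin_le_nhds (eventually_all.2 fun k => ?_)
      have : Tendsto (fun c : ℝ => c * v k) (nhds 1) (nhds (1 * v k)) :=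
        (continuous_id.mul continuous_const).tendsto 1
      exact this.eventually_const_lt (by simpa using hMv k)
    have h2 : ∀ᶠ c in nhdsWithin (1 : ℝ) (Iio 1), 0 < c :=
      Filter.Eventually.filter_mono nhdsWithin_le_nhds (lt_mem_nhds one_pos)
    obtain ⟨c, a, b, e⟩ := (h1.and (h2.and self_mem_nhdsWithin)).exists
    exact ⟨c, a, b, e⟩
  obtain ⟨t, ht, ht0⟩ := ((eventually_all.2 fun k =>
    local_bound hprob hmeas hsub hcont v hv k c (hc k)).and self_mem_nhdsWithin).exists
  have ht0 : 0 < t := ht0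
  set w : Fin d → ℝ≥0∞ := fun j => ENNReal.ofReal (t * v j) with hw
  set C : ℝ≥0∞ := ENNReal.ofReal c
  have hC1 : C < 1 := by simpa [C] using hc1
  have hstep : ∀ k, logGenFun P X 1 w k ≤ C * w k := by
    intro k
    refine (ht k).trans (le_of_eq ?_)
    rw [hw, ← ENNReal.ofReal_mul hc0.le]
    congr 1; ring
  have hn : ∀ n k, (logGenFun P X 1)^[n] w k ≤ C ^ n * w k := by
    intro n
    induction n with
    | zero => intro k; simp
    | succ n ih =>
      intro k
      rw [Function.iterate_succ_apply']
      calc _ ≤ logGenFun P X 1 (fun j => C ^ n * w j) k := logGenFun_mono 1 ih k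
        _ ≤ C ^ n * logGenFun P X 1 w k :=
          logGenFun_scale hprob hmeas 1 (pow_le_one' hC1.le n) w k
        _ ≤ C ^ n * (C * w k) := mul_le_mul_right (hstep k) _
        _ = _ := by ring
  refine ⟨w, fun k => by simpa [hw] using mul_pos ht0 (hv k), ?_⟩
  refine tendsto_pi_nhds.2 fun k => ?_
  refine tendsto_of_tendsto_of_tendsto_of_le_of_le tendsto_const_nhds ?_
    (fun n => zero_le) (fun n => hn n k)
  have := ENNReal.Tendsto.mul_const (b := w k) (ENNReal.tendsto_pow_atTop_nhds_zero_of_lt_one hC1)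
    (Or.inr ofReal_ne_top)
  simpa using this

theorem low_bound (hprob : ∀ k, IsProbabilityMeasure (P k)) (n : ℕ) (k : Fin d)
    (l : Fin d → ℝ≥0∞) (m : ℝ≥0∞) {S : Set Ω} (hS : MeasurableSet S) (hpos : 0 < P k S)
    (h : ∀ ω ∈ S, eexp m ≤ ∏ j, eexp (l j) ^ X n ω j) :
    m ≤ logGenFun P X n l k + elog (P k S)⁻¹ := by
  have := hprob k
  rw [← eexp_le_iff, eexp_add, eexp_logGenFun hprob, eexp_elog (by simpa using prob_le_one)]
  have h1 : eexp m * P k S ≤ genFun P X n (fun j => eexp (l j)) k := by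
    rw [← setLIntegral_const]
    exact (setLIntegral_mono' hS h).trans (setLIntegral_le_lintegral _ _)
  calc eexp m = eexp m * P k S * (P k S)⁻¹ := by
        rw [mul_assoc, ENNReal.mul_inv_cancel hpos.ne' (measure_ne_top _ _), mul_one]
    _ ≤ _ := mul_le_mul_left h1 _

theorem elog_inv_ne_top {x : ℝ≥0∞} (h : 0 < x) : elog x⁻¹ ≠ ⊤ := by
  unfold elog
  simp [h.ne']

theorem reach (hprob : ∀ k, IsProbabilityMeasure (P k)) (hmeas : ∀ n, Measurable (X n))
    (hPR : PositiveRegular P X) :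
    ∃ (N : ℕ) (L : ℝ≥0∞), L ≠ ⊤ ∧ ∀ l k j, l j ≤ logGenFun P X N l k + L := by
  obtain ⟨N, hN⟩ := hPR
  refine ⟨N, ∑ k, ∑ j, elog (P k {ω | 1 ≤ X N ω j})⁻¹, ?_, fun l k j => ?_⟩
  · exact (ENNReal.sum_lt_top.2 fun k _ => ENNReal.sum_lt_top.2 fun j _ =>
      (elog_inv_ne_top (hN k j)).lt_top).ne
  · have hS : MeasurableSet {ω | 1 ≤ X N ω j} :=
      hmeas N (MeasurableSet.of_discrete (s := {x : Fin d → ℕ | 1 ≤ x j}))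
    refine (low_bound (X := X) hprob N k l (l j) hS (hN k j) fun ω hω => ?_).trans ?_
    · calc eexp (l j) ≤ eexp (l j) ^ X N ω j :=
            le_self_pow₀ (one_le_eexp _) (by have : 1 ≤ X N ω j := hω; omega)
        _ ≤ _ := Finset.single_le_prod' (f := fun j => eexp (l j) ^ X N ω j)
            (fun i _ => one_le_pow_of_one_le' (one_le_eexp _) _) (Finset.mem_univ j)
    · refine add_le_add le_rfl ?_
      refine le_trans ?_ (Finset.single_le_sum (fun _ _ => zero_le) (Finset.mem_univ k))
      exact Finset.single_le_sum (f := fun j => elog (P k {ω | 1 ≤ X N ω j})⁻¹)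
        (fun _ _ => zero_le) (Finset.mem_univ j)

theorem double (hprob : ∀ k, IsProbabilityMeasure (P k)) (hmeas : ∀ n, Measurable (X n))
    (hNS : NonSingular P X) :
    ∃ (k : Fin d) (L : ℝ≥0∞), L ≠ ⊤ ∧ ∀ l m, (∀ j, m ≤ l j) → 2 * m ≤ logGenFun P X 1 l k + L := by
  obtain ⟨k, hk⟩ := hNS
  refine ⟨k, _, elog_inv_ne_top hk, fun l m hm => ?_⟩
  have hS : MeasurableSet {ω | 2 ≤ ∑ j, X 1 ω j} :=
    hmeas 1 (MeasurableSet.of_discrete (s := {x : Fin d → ℕ | 2 ≤ ∑ j, x j}))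
  refine low_bound hprob 1 k l (2 * m) hS hk fun ω hω => ?_
  rw [two_mul, eexp_add, ← pow_two]
  calc eexp m ^ 2 ≤ eexp m ^ (∑ j, X 1 ω j) := pow_le_pow_right₀ (one_le_eexp _) hω
    _ = ∏ j, eexp m ^ X 1 ω j := by rw [Finset.prod_pow_eq_pow_sum]
    _ ≤ _ := Finset.prod_le_prod' fun j _ => pow_le_pow_left' (eexp_mono (hm j)) _

theorem escape (hprob : ∀ k, IsProbabilityMeasure (P k)) (hmeas : ∀ n, Measurable (X n))
    (hiter : ∀ n q, (genFun P X 1)^[n] q = genFun P X n q)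
    (hPR : PositiveRegular P X) (hNS : NonSingular P X) :
    ∃ R : ℝ≥0∞, R ≠ ⊤ ∧ ∀ l, (∀ k, R ≤ l k) → l ∈ basinInfty P X := by
  obtain ⟨N, L, hL, hreach⟩ := reach hprob hmeas hPR
  obtain ⟨k0, L1, hL1, hdouble⟩ := double hprob hmeas hNS
  have hCt : L + L1 ≠ ⊤ := ENNReal.add_ne_top.2 ⟨hL, hL1⟩
  have hstep : ∀ l m, L + L1 + 1 ≤ m → (∀ j, m ≤ l j) →
      ∀ k, m + 1 ≤ (logGenFun P X 1)^[N + 1] l k := by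
    intro l m hm hl k
    rw [Function.iterate_succ_apply, iter_eq hprob hiter]
    have h1 := hdouble l m hl
    have h2 := hreach (logGenFun P X 1 l) k k0
    refine (ENNReal.add_le_add_iff_right hCt).1 ?_
    calc m + 1 + (L + L1) = m + (L + L1 + 1) := by ring
      _ ≤ m + m := add_le_add le_rfl hm
      _ = 2 * m := (two_mul m).symm
      _ ≤ _ := h1
      _ ≤ _ := add_le_add h2 le_rfl
      _ = _ := by ring
  refine ⟨L + L1 + 1, ENNReal.add_ne_top.2 ⟨hCt, one_ne_top⟩, fun l hl => ?_⟩
  have hi : ∀ i : ℕ, ∀ k, L + L1 + 1 + i ≤ (logGenFun P X 1)^[(N + 1) * i] l k := by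
    intro i
    induction i with
    | zero => intro k; simpa using hl k
    | succ i ih =>
      intro k
      have := hstep _ (L + L1 + 1 + i) le_self_add ih k
      rw [← Function.iterate_add_apply] at this
      rw [mul_add, mul_one, add_comm ((N + 1) * i)]
      refine le_trans (le_of_eq ?_) this
      push_cast; ring
  refine ENNReal.eq_top_of_forall_nnreal_le fun r => ?_
  obtain ⟨i, hri⟩ := exists_nat_ge r
  have hri' : (r : ℝ≥0∞) ≤ i := by exact_mod_cast hri
  refine le_trans hri' (le_limsup_of_frequently_le ?_)
  refine frequently_atTop.2 fun a => ?_
  refine ⟨(N + 1) * (max i a), ?_, ?_⟩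
  · nlinarith [le_max_right i a, Nat.zero_le (N * max i a)]
  · refine le_trans ?_ (Finset.single_le_sum (fun _ _ => zero_le) (Finset.mem_univ k0))
    refine le_trans ?_ (hi (max i a) k0)
    refine le_trans ?_ le_add_self
    exact_mod_cast le_max_left i a

theorem basinInfty_iff (hprob : ∀ k, IsProbabilityMeasure (P k)) (hmeas : ∀ n, Measurable (X n))
    (hiter : ∀ n q, (genFun P X 1)^[n] q = genFun P X n q)
    (hPR : PositiveRegular P X) (hNS : NonSingular P X) :
    ∃ R : ℝ≥0∞, R ≠ ⊤ ∧ ∀ l, l ∈ basinInfty P X ↔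
      ∃ n, ∀ k, R < (logGenFun P X 1)^[n] l k := by
  obtain ⟨N, L, hL, hreach⟩ := reach hprob hmeas hPR
  obtain ⟨R, hR, hesc⟩ := escape hprob hmeas hiter hPR hNS
  refine ⟨R, hR, fun l => ⟨fun h => ?_, fun ⟨n, hn⟩ => ?_⟩⟩
  · have hlt : (d : ℝ≥0∞) * (R + L) < limsup (fun n => ∑ k, (logGenFun P X 1)^[n] l k) atTop := by
      rw [show limsup (fun n => ∑ k, (logGenFun P X 1)^[n] l k) atTop = ⊤ from h]
      exact (ENNReal.mul_ne_top (ENNReal.natCast_ne_top d) (ENNReal.add_ne_top.2 ⟨hR, hL⟩)).lt_top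
    obtain ⟨n, hn⟩ := (frequently_lt_of_lt_limsup (by isBoundedDefault) hlt).exists
    obtain ⟨j, hj⟩ : ∃ j, R + L < (logGenFun P X 1)^[n] l j := by
      by_contra hcon
      push Not at hcon
      refine absurd hn (not_lt.2 ?_)
      refine (Finset.sum_le_sum fun k _ => hcon k).trans ?_
      simp [mul_add]
    refine ⟨N + n, fun k => ?_⟩
    rw [Function.iterate_add_apply, iter_eq hprob hiter N]
    exact (ENNReal.add_lt_add_iff_right hL).1 (lt_of_lt_of_le hj (hreach _ k j))
  · have := hesc _ (fun k => (hn k).le)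
    have h2 : limsup (fun i => ∑ k, (logGenFun P X 1)^[i] ((logGenFun P X 1)^[n] l) k) atTop = ⊤ :=
      this
    simp only [← Function.iterate_add_apply] at h2
    rw [limsup_nat_add (fun i => ∑ k, (logGenFun P X 1)^[i] l k) n] at h2
    exact h2

theorem basinZero_iff {w : Fin d → ℝ≥0∞} (hw : ∀ k, 0 < w k)
    (ht : Tendsto (fun n => (logGenFun P X 1)^[n] w) atTop (nhds 0)) (l : Fin d → ℝ≥0∞) :
    l ∈ basinZero P X ↔ ∃ n, ∀ k, (logGenFun P X 1)^[n] l k < w k := by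
  constructor
  · intro h
    have h1 := tendsto_pi_nhds.1 (show Tendsto _ _ _ from h)
    exact (eventually_all.2 fun k => (h1 k).eventually_lt_const (hw k)).exists
  · rintro ⟨n, hn⟩
    show Tendsto (fun n => (logGenFun P X 1)^[n] l) atTop (nhds 0)
    rw [← tendsto_add_atTop_iff_nat n]
    refine tendsto_pi_nhds.2 fun k => ?_
    refine tendsto_of_tendsto_of_tendsto_of_le_of_le tendsto_const_nhds
      (tendsto_pi_nhds.1 ht k) (fun i => zero_le) (fun i => ?_)
    simp only [Function.iterate_add_apply]
    exact (logGenFun_mono 1).iterate i (fun k => (hn k).le) k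

theorem survive (hprob : ∀ k, IsProbabilityMeasure (P k)) (hmeas : ∀ n, Measurable (X n))
    (hiter : ∀ n q, (genFun P X 1)^[n] q = genFun P X n q)
    {w : Fin d → ℝ≥0∞} (hw : ∀ k, 0 < w k)
    (ht : Tendsto (fun n => (logGenFun P X 1)^[n] w) atTop (nhds 0)) (k : Fin d) :
    Tendsto (fun n => P k {ω | X n ω ≠ 0}) atTop (nhds 0) := by
  have := hprob k
  obtain ⟨δ, hδ0, hδt, hδ⟩ : ∃ δ : ℝ≥0∞, δ ≠ 0 ∧ δ ≠ ⊤ ∧ ∀ j, 1 + δ ≤ eexp (w j) := by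
    have h1 : ∀ᶠ δ in nhdsWithin (0 : ℝ≥0∞) (Ioi 0), ∀ j, 1 + δ < eexp (w j) := by
      refine Filter.Eventually.filter_mono nhdsWithin_le_nhds (eventually_all.2 fun j => ?_)
      have : Tendsto (fun δ : ℝ≥0∞ => 1 + δ) (nhds 0) (nhds (1 + 0)) :=
        tendsto_const_nhds.add tendsto_id
      exact this.eventually_lt_const (by simpa using one_lt_eexp (hw j))
    have h2 : ∀ᶠ δ in nhdsWithin (0 : ℝ≥0∞) (Ioi 0), δ < ⊤ :=
      Filter.Eventually.filter_mono nhdsWithin_le_nhds (gt_mem_nhds zero_lt_top)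
    obtain ⟨δ, a, b, c⟩ := (h1.and (h2.and self_mem_nhdsWithin)).exists
    exact ⟨δ, (show 0 < δ from c).ne', b.ne, fun j => (a j).le⟩
  have hS : ∀ n, MeasurableSet {ω | X n ω ≠ 0} := fun n =>
    hmeas n (MeasurableSet.of_discrete (s := {x : Fin d → ℕ | x ≠ 0}))
  have hb : ∀ n, δ * P k {ω | X n ω ≠ 0} ≤ eexp ((logGenFun P X 1)^[n] w k) - 1 := by
    intro n
    rw [iter_eq hprob hiter, eexp_logGenFun hprob]
    refine ENNReal.le_sub_of_add_le_left one_ne_top ?_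
    have : 1 + δ * P k {ω | X n ω ≠ 0} =
        ∫⁻ ω, 1 + {ω | X n ω ≠ 0}.indicator (fun _ => δ) ω ∂(P k) := by
      rw [lintegral_add_left measurable_const, lintegral_indicator_const (hS n)]
      simp
    rw [this]
    refine lintegral_mono fun ω => ?_
    by_cases hω : X n ω = 0
    · simp [hω]
    · have hmem : ω ∈ {ω | X n ω ≠ 0} := hω
      simp only [Set.indicator_of_mem hmem]
      obtain ⟨j, hj⟩ := Function.ne_iff.1 hω
      calc 1 + δ ≤ eexp (w j) := hδ j
        _ ≤ eexp (w j) ^ X n ω j := le_self_pow₀ (one_le_eexp _) hj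
        _ ≤ _ := Finset.single_le_prod' (f := fun j => eexp (w j) ^ X n ω j)
            (fun i _ => one_le_pow_of_one_le' (one_le_eexp _) _) (Finset.mem_univ j)
  have hlim : Tendsto (fun n => (eexp ((logGenFun P X 1)^[n] w k) - 1) / δ) atTop (nhds 0) := by
    have h1 := (eexp_continuous.tendsto 0).comp (tendsto_pi_nhds.1 ht k)
    rw [eexp_zero] at h1
    have h2 := ENNReal.Tendsto.sub h1 (tendsto_const_nhds (x := (1 : ℝ≥0∞))) (Or.inl one_ne_top)
    have h3 := ENNReal.Tendsto.div_const h2 (Or.inr hδ0)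
    simpa using h3
  refine tendsto_of_tendsto_of_tendsto_of_le_of_le tendsto_const_nhds hlim
    (fun n => zero_le) (fun n => ?_)
  rw [ENNReal.le_div_iff_mul_le (Or.inl hδ0) (Or.inl hδt), mul_comm]
  exact hb n

theorem instab (hprob : ∀ k, IsProbabilityMeasure (P k)) (hmeas : ∀ n, Measurable (X n))
    (hiter : ∀ n q, (genFun P X 1)^[n] q = genFun P X n q)
    (hsurv : ∀ k, Tendsto (fun n => P k {ω | X n ω ≠ 0}) atTop (nhds 0))
    (l : Fin d → ℝ≥0∞) {s : ℝ≥0∞} (hs : s < 1) (hl : l ∉ basinInfty P X) :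
    (fun j => s * l j) ∈ basinZero P X := by
  have hst : s ≠ ⊤ := ne_top_of_lt hs
  have hs1 : s.toReal < 1 := by simpa using (ENNReal.toReal_lt_toReal hst one_ne_top).2 hs
  obtain ⟨C, hC1, hC2⟩ := exists_between (lt_top_iff_ne_top.2
    (show limsup (fun n => ∑ k, (logGenFun P X 1)^[n] l k) atTop ≠ ⊤ from hl))
  have hev := eventually_lt_of_limsup_lt hC1
  refine tendsto_pi_nhds.2 fun k => ?_
  have := hprob k
  have hS : ∀ n, MeasurableSet {ω | X n ω ≠ 0} := fun n =>
    hmeas n (MeasurableSet.of_discrete (s := {x : Fin d → ℕ | x ≠ 0}))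
  have hbound : ∀ᶠ n in atTop, (logGenFun P X 1)^[n] (fun j => s * l j) k ≤
      elog (1 + eexp C ^ s.toReal * P k {ω | X n ω ≠ 0} ^ (1 - s.toReal)) := by
    filter_upwards [hev] with n hn
    rw [iter_eq hprob hiter] at hn ⊢
    refine elog_mono ?_
    have hgC : genFun P X n (fun j => eexp (l j)) k ≤ eexp C := by
      rw [← eexp_logGenFun hprob]
      exact eexp_mono ((Finset.single_le_sum (f := fun k => logGenFun P X n l k)
        (fun _ _ => zero_le) (Finset.mem_univ k)).trans hn.le)
    simp only [eexp_smul hst]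
    unfold genFun
    rw [← lintegral_add_compl _ (hS n), add_comm]
    refine add_le_add ?_ ?_
    · calc _ ≤ ∫⁻ _ in {ω | X n ω ≠ 0}ᶜ, 1 ∂(P k) := by
            refine setLIntegral_mono' (hS n).compl fun ω hω => ?_
            have : X n ω = 0 := by simpa using hω
            simp [this]
        _ ≤ 1 := by simpa using prob_le_one
    · refine (scale_set hmeas n _ toReal_nonneg hs1.le (fun j => eexp (l j))).trans ?_
      rw [Measure.restrict_apply_univ]
      refine mul_le_mul_left (ENNReal.rpow_le_rpow ?_ toReal_nonneg) _
      exact (setLIntegral_le_lintegral _ _).trans hgC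
  refine tendsto_of_tendsto_of_tendsto_of_le_of_le' tendsto_const_nhds ?_
    (Eventually.of_forall fun n => zero_le) hbound
  have h1 : Tendsto (fun n => P k {ω | X n ω ≠ 0} ^ (1 - s.toReal)) atTop (nhds 0) := by
    have := (ENNReal.continuous_rpow_const (y := 1 - s.toReal)).tendsto 0 |>.comp (hsurv k)
    rw [ENNReal.zero_rpow_of_pos (by linarith)] at this
    exact this
  have h2 := ENNReal.Tendsto.const_mul (a := eexp C ^ s.toReal) h1
    (Or.inr (ENNReal.rpow_ne_top_of_nonneg toReal_nonneg (eexp_ne_top hC2.ne)))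
  rw [mul_zero] at h2
  have h3 := (elog_continuous.tendsto (1 + 0)).comp (tendsto_const_nhds.add h2)
  rw [add_zero, elog_one] at h3
  exact h3

end Main


/-- Under the hypotheses of the main theorem, for every unit vector
`u ∈ [0,∞)^d` (normalized in the `ℓ¹` norm: `∑ⱼ uⱼ = 1`) there is exactly one `r > 0`
with `r • u ∈ [0,∞)^d \ (S₀ ∪ S_∞)`. -/
theorem ray_intersects_once
    {d : ℕ} {Ω : Type*} [MeasurableSpace Ω]
    (P : Fin d → Measure Ω) (X : ℕ → Ω → Fin d → ℕ)
    (hprob : ∀ k, IsProbabilityMeasure (P k))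
    (hmeas : ∀ n, Measurable (X n))
    (hiter : ∀ n q, (genFun P X 1)^[n] q = genFun P X n q)
    (hsub : Subcritical P X)
    (hPR : PositiveRegular P X)
    (hNS : NonSingular P X)
    (hcont : GenFunContinuous P X)
    (u : Fin d → ℝ≥0∞) (hufin : ∀ j, u j ≠ ⊤) (hu1 : ∑ j, u j = 1) :
    ∃! r : ℝ≥0∞, 0 < r ∧ r ≠ ⊤ ∧
      (fun j => r * u j) ∉ basinZero P X ∪ basinInfty P X := by
  have hd : Nonempty (Fin d) := by
    by_contra hne
    rw [not_nonempty_iff] at hne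
    simp at hu1
  obtain ⟨w, hw, hwt⟩ := attract hd hprob hmeas hsub hcont
  obtain ⟨R, hR, hinf⟩ := basinInfty_iff hprob hmeas hiter hPR hNS
  have hzero := basinZero_iff hw hwt
  have hsurv := survive hprob hmeas hiter hw hwt
  have hgc : ∀ n k, Continuous (fun r : ℝ≥0∞ => (logGenFun P X 1)^[n] (fun j => r * u j) k) := by
    intro n k
    exact (continuous_apply k).comp (((logGenFun_continuous hcont).iterate n).comp
      (continuous_pi fun j => ENNReal.continuous_mul_const (hufin j)))
  have key : ∀ r r' : ℝ≥0∞, r < r' → r' ≠ ⊤ → (fun j => r * u j) ∉ basinZero P X →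
      (fun j => r' * u j) ∉ basinInfty P X → False := by
    intro r r' hlt hr' h1 h2
    have hr0 : r' ≠ 0 := (lt_of_le_of_lt zero_le hlt).ne'
    have hs : r / r' < 1 := (ENNReal.div_lt_iff (Or.inl hr0) (Or.inl hr')).2 (by simpa using hlt)
    have := instab hprob hmeas hiter hsurv (fun j => r' * u j) hs h2
    simp only [← mul_assoc, ENNReal.div_mul_cancel hr0 hr'] at this
    exact h1 this
  obtain ⟨r, hrA, hrB⟩ : ∃ r : ℝ≥0∞, (fun j => r * u j) ∉ basinZero P X ∧
      (fun j => r * u j) ∉ basinInfty P X := by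
    by_contra hcon
    push Not at hcon
    have hA : IsOpen {r : ℝ≥0∞ | (fun j => r * u j) ∈ basinZero P X} := by
      have : {r : ℝ≥0∞ | (fun j => r * u j) ∈ basinZero P X} =
          ⋃ n, ⋂ k, {r | (logGenFun P X 1)^[n] (fun j => r * u j) k < w k} := by
        ext r; simp [hzero]
      rw [this]
      exact isOpen_iUnion fun n => isOpen_iInter_of_finite fun k =>
        isOpen_lt (hgc n k) continuous_const
    have hB : IsOpen {r : ℝ≥0∞ | (fun j => r * u j) ∈ basinInfty P X} := by
      have : {r : ℝ≥0∞ | (fun j => r * u j) ∈ basinInfty P X} =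
          ⋃ n, ⋂ k, {r | R < (logGenFun P X 1)^[n] (fun j => r * u j) k} := by
        ext r; simp [hinf]
      rw [this]
      exact isOpen_iUnion fun n => isOpen_iInter_of_finite fun k =>
        isOpen_lt continuous_const (hgc n k)
    have hdisj : ∀ l, l ∈ basinZero P X → l ∉ basinInfty P X := by
      intro l h1 h2
      have h3 : Tendsto (fun n => ∑ k, (logGenFun P X 1)^[n] l k) atTop
          (nhds (∑ k : Fin d, (0 : Fin d → ℝ≥0∞) k)) :=
        tendsto_finsetSum _ fun k _ => tendsto_pi_nhds.1 h1 k
      have h4 := h3.limsup_eq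
      rw [show limsup (fun n => ∑ k, (logGenFun P X 1)^[n] l k) atTop = ⊤ from h2] at h4
      simp at h4
    have h0 : (fun j => (0 : ℝ≥0∞) * u j) ∈ basinZero P X := by
      rw [hzero]
      exact ⟨0, fun k => by simpa using hw k⟩
    have htop : (fun j => (⊤ : ℝ≥0∞) * u j) ∈ basinInfty P X := by
      rw [hinf]
      obtain ⟨N, L, hL, hreach⟩ := reach hprob hmeas hPR
      obtain ⟨j, hj⟩ : ∃ j, u j ≠ 0 := by
        by_contra hcon
        push Not at hcon
        simp [hcon] at hu1
      refine ⟨N, fun k => ?_⟩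
      rw [iter_eq hprob hiter]
      have h5 := hreach (fun j => (⊤ : ℝ≥0∞) * u j) k j
      simp only [ENNReal.top_mul hj, top_le_iff, ENNReal.add_eq_top, hL, or_false] at h5
      rw [h5]
      exact hR.lt_top
    rcases isPreconnected_iff_subset_of_disjoint.1 (isPreconnected_univ (α := ℝ≥0∞)) _ _ hA hB
      (fun r _ => by
        by_cases h : (fun j => r * u j) ∈ basinZero P X
        · exact Or.inl h
        · exact Or.inr (hcon r h))
      (by
        ext r
        simp only [univ_inter, mem_inter_iff, mem_ofPred_eq, mem_empty_iff_false, iff_false, not_and]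
        exact hdisj _) with h | h
    · exact hdisj _ (h (mem_univ ⊤)) htop
    · exact hdisj _ h0 (h (mem_univ 0))
  have h0 : r ≠ 0 := by
    rintro rfl
    refine hrA ((hzero _).2 ⟨0, fun k => by simpa using hw k⟩)
  have htop : r ≠ ⊤ := by
    rintro rfl
    refine hrB ((hinf _).2 ?_)
    obtain ⟨N, L, hL, hreach⟩ := reach hprob hmeas hPR
    obtain ⟨j, hj⟩ : ∃ j, u j ≠ 0 := by
      by_contra hcon
      push Not at hcon
      simp [hcon] at hu1
    refine ⟨N, fun k => ?_⟩
    rw [iter_eq hprob hiter]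
    have h5 := hreach (fun j => (⊤ : ℝ≥0∞) * u j) k j
    simp only [ENNReal.top_mul hj, top_le_iff, ENNReal.add_eq_top, hL, or_false] at h5
    rw [h5]
    exact hR.lt_top
  refine ⟨r, ⟨pos_iff_ne_zero.2 h0, htop, fun h => h.elim hrA hrB⟩, ?_⟩
  rintro r' ⟨_, ht', hn'⟩
  rw [mem_union, not_or] at hn'
  rcases lt_trichotomy r' r with h | h | h
  · exact (key r' r h htop hn'.1 hrB).elim
  · exact h
  · exact (key r r' h ht' hrA hn'.2).elim
end

section
/- (Main theorem, d-type case.) Let X be a d-type branching process whose mean matrix has largest eigenvalue ρ < 1, which is positive regular and non-singular, and whose generating function components f_k are continuous from (0,∞]^d to (0,∞]. Then there exists q ∈ (1,∞)^d with f(q) = q. -/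
open MeasureTheory ProbabilityTheory ENNReal Filter Set

def ScDom {I V : Type*} (v : I → V → ℤ) (σ : Finset V) : Prop :=
  ∀ t, ∃ i, ∀ s ∈ σ, v i t ≤ v i s

open Classical in
lemma sc_two_rooms {I V : Type*} [Fintype I] [Fintype V] (v : I → V → ℤ)
    (hinj : ∀ i, Function.Injective (v i)) (τ : Finset V) (hτ : ScDom v τ)
    (hne : τ.Nonempty) (hcard : τ.card + 1 = Fintype.card I)
    (hext : ∀ j, ∃ x, ∀ i, i ≠ j → ∃ s ∈ τ, v i s < v i x) :
    Even ((Finset.univ.filter fun x => x ∉ τ ∧ ScDom v (insert x τ)).card) := by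
  have hm : ∀ i, ∃ s ∈ τ, ∀ s' ∈ τ, v i s ≤ v i s' := fun i => Finset.exists_min_image τ (v i) hne
  choose m hmτ hmin using hm
  have hmeq : ∀ i s, s ∈ τ → (∀ s' ∈ τ, v i s ≤ v i s') → m i = s := by
    intro i s hs h
    exact hinj i (le_antisymm (hmin i s hs) (h _ (hmτ i)))
  have hsurj : ∀ s ∈ τ, ∃ i, m i = s := by
    intro s hs
    obtain ⟨i, hi⟩ := hτ s
    exact ⟨i, hmeq i s hs hi⟩
  obtain ⟨i1, -, i2, -, h12, hm12⟩ := Finset.exists_ne_map_eq_of_card_lt_of_maps_to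
    (s := (Finset.univ : Finset I)) (t := τ) (f := m) (by rw [Finset.card_univ]; omega)
    (fun i _ => hmτ i)
  have hI : ∀ j, (∀ s ∈ τ, ∃ i, i ≠ j ∧ m i = s) → ∀ a b, a ≠ j → b ≠ j → m a = m b → a = b := by
    intro j hj a b ha hb hab
    have := Finset.injOn_of_surjOn_of_card_le (s := Finset.univ.erase j) (t := τ) m
      (fun i _ => hmτ i) (by
        intro s hs
        obtain ⟨i, hi, his⟩ := hj s hs
        exact ⟨i, by simpa using hi, his⟩)
      (by rw [Finset.card_erase_of_mem (Finset.mem_univ _), Finset.card_univ]; omega)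
    exact this (by simpa using ha) (by simpa using hb) hab
  have hU1 : ∀ j, (∀ s ∈ τ, ∃ i, i ≠ j ∧ m i = s) → j = i1 ∨ j = i2 := by
    intro j hj
    by_contra hcon
    push Not at hcon
    exact h12 (hI j hj i1 i2 (Ne.symm hcon.1) (Ne.symm hcon.2) hm12)
  have hU2 : ∀ j, (j = i1 ∨ j = i2) → ∀ s ∈ τ, ∃ i, i ≠ j ∧ m i = s := by
    intro j hj s hs
    obtain ⟨i, hi⟩ := hsurj s hs
    by_cases hij : i = j
    · rcases hj with rfl | rfl
      · exact ⟨i2, h12.symm, by rw [← hm12, ← hij, hi]⟩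
      · exact ⟨i1, h12, by rw [hm12, ← hij, hi]⟩
    · exact ⟨i, hij, hi⟩
  have hX : ∀ j, ∃ x, (∀ i, i ≠ j → v i (m i) < v i x) ∧
      ∀ y, (∀ i, i ≠ j → v i (m i) < v i y) → v j y ≤ v j x := by
    intro j
    obtain ⟨x0, hx0⟩ := hext j
    obtain ⟨x, hx, hxm⟩ := Finset.exists_max_image
      (Finset.univ.filter fun x => ∀ i, i ≠ j → v i (m i) < v i x) (v j)
      ⟨x0, by
        simp only [Finset.mem_filter, Finset.mem_univ, true_and]
        intro i hi
        obtain ⟨s, hs, hsx⟩ := hx0 i hi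
        exact lt_of_le_of_lt (hmin i s hs) hsx⟩
    simp only [Finset.mem_filter, Finset.mem_univ, true_and] at hx hxm
    exact ⟨x, hx, hxm⟩
  choose X hXM hXmax using hX
  have key : (Finset.univ.filter fun x => x ∉ τ ∧ ScDom v (insert x τ)) = {X i1, X i2} := by
    ext x
    simp only [Finset.mem_filter, Finset.mem_univ, true_and, Finset.mem_insert,
      Finset.mem_singleton]
    constructor
    · rintro ⟨hx, hd⟩
      obtain ⟨j, hj⟩ := hd x
      have hj' : ∀ k, (∀ s ∈ τ, v k x ≤ v k s) → ∀ s ∈ τ, ∀ i,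
          (∀ s' ∈ insert x τ, v i s ≤ v i s') → i ≠ k := by
        rintro k hk s hs i hi rfl
        have := hinj i (le_antisymm (hi x (by simp)) (hk s hs))
        exact hx (this ▸ hs)
      have hjx : ∀ s ∈ τ, v j x ≤ v j s := fun s hs => hj s (by simp [hs])
      have hs1 : ∀ s ∈ τ, ∃ i, i ≠ j ∧ m i = s := by
        intro s hs
        obtain ⟨i, hi⟩ := hd s
        exact ⟨i, hj' j hjx s hs i hi, hmeq i s hs fun s' h' => hi s' (by simp [h'])⟩
      have hM : ∀ i, i ≠ j → v i (m i) < v i x := by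
        intro i hij
        by_contra hcon
        push Not at hcon
        have hix : ∀ s ∈ τ, v i x ≤ v i s := fun s hs => hcon.trans (hmin i s hs)
        obtain ⟨i', hi'⟩ := hd (m i)
        have e := hmeq i' _ (hmτ i) fun s' h' => hi' s' (by simp [h'])
        exact hj' i hix _ (hmτ i) i' hi'
          (hI j hs1 i' i (hj' j hjx _ (hmτ i) i' hi') hij e)
      have hxX : x = X j := by
        obtain ⟨i, hi⟩ := hd (X j)
        by_cases hij : i = j
        · subst hij
          exact hinj i (le_antisymm (hXmax i x hM) (hi x (by simp)))
        · exact absurd (hi (m i) (by simp [hmτ])) (not_le.mpr (hXM j i hij))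
      rcases hU1 j hs1 with rfl | rfl
      · exact Or.inl hxX
      · exact Or.inr hxX
    · intro hx
      obtain ⟨j, hj, rfl⟩ : ∃ j, (j = i1 ∨ j = i2) ∧ x = X j := by
        rcases hx with h | h
        · exact ⟨i1, Or.inl rfl, h⟩
        · exact ⟨i2, Or.inr rfl, h⟩
      have hjτ : ∀ s ∈ τ, v j (X j) ≤ v j s := by
        obtain ⟨i, hi⟩ := hτ (X j)
        by_cases hij : i = j
        · subst hij; exact hi
        · exact absurd (hi (m i) (hmτ i)) (not_le.mpr (hXM j i hij))
      refine ⟨?_, ?_⟩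
      · intro hmem
        obtain ⟨i, hij, hi⟩ := hU2 j hj _ hmem
        have := hXM j i hij
        rw [hi] at this
        exact lt_irrefl _ this
      · intro t
        by_cases ht : ∀ i, i ≠ j → v i (m i) < v i t
        · refine ⟨j, fun s hs => ?_⟩
          rcases Finset.mem_insert.1 hs with rfl | hs
          · exact hXmax j t ht
          · exact (hXmax j t ht).trans (hjτ s hs)
        · push Not at ht
          obtain ⟨i, hij, hi⟩ := ht
          refine ⟨i, fun s hs => ?_⟩
          rcases Finset.mem_insert.1 hs with rfl | hs
          · exact hi.trans (hXM j i hij).le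
          · exact hi.trans (hmin i s hs)
  have hne12 : X i1 ≠ X i2 := by
    intro h
    obtain ⟨i, hi⟩ := hτ (X i1)
    have h1 := hi _ (hmτ i)
    by_cases hii : i = i1
    · have := hXM i2 i (by rw [hii]; exact h12)
      rw [← h] at this
      omega
    · have := hXM i1 i hii
      omega
  rw [key, Finset.card_pair hne12]
  exact even_two

open Classical in
lemma sc_scarf {I V : Type*} [Fintype I] [Fintype V] (v : I → V → ℤ)
    (hinj : ∀ i, Function.Injective (v i)) (s : I → V)
    (hs1 : ∀ i x, x ≠ s i → v i (s i) < v i x)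
    (hs2 : ∀ i j x, j ≠ i → (∀ k, x ≠ s k) → v i x < v i (s j))
    (x0 : V) (hx0 : ∀ k, x0 ≠ s k) (c : V → I) (hc : ∀ i, c (s i) = i) (i0 : I) :
    ∃ σ : Finset V, ScDom v σ ∧ σ.card = Fintype.card I ∧ σ.image c = Finset.univ := by
  by_contra hcon
  push Not at hcon
  have hsinj : Function.Injective s := Function.LeftInverse.injective hc
  let D : Finset (Finset V) := Finset.univ.filter fun τ =>
    ScDom v τ ∧ τ.card + 1 = Fintype.card I ∧ τ.image c = Finset.univ.erase i0
  let R : Finset (Finset V) := Finset.univ.filter fun σ =>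
    ScDom v σ ∧ σ.card = Fintype.card I
  have hcount : (D.sigma fun τ => Finset.univ.filter fun x => x ∉ τ ∧ ScDom v (insert x τ)).card
      = (R.sigma fun σ => σ.filter fun x => (σ.erase x).image c = Finset.univ.erase i0).card := by
    refine Finset.card_bij' (fun p _ => ⟨insert p.2 p.1, p.2⟩) (fun p _ => ⟨p.1.erase p.2, p.2⟩)
      ?_ ?_ ?_ ?_
    · rintro ⟨τ, x⟩ h
      simp only [D, R, Finset.mem_sigma, Finset.mem_filter, Finset.mem_univ, true_and] at h ⊢
      obtain ⟨⟨h1, h2, h3⟩, h4, h5⟩ := h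
      refine ⟨⟨h5, by rw [Finset.card_insert_of_notMem h4, h2]⟩, by simp, ?_⟩
      rw [Finset.erase_insert h4, h3]
    · rintro ⟨σ, x⟩ h
      simp only [D, R, Finset.mem_sigma, Finset.mem_filter, Finset.mem_univ, true_and] at h ⊢
      obtain ⟨⟨h1, h2⟩, h3, h4⟩ := h
      refine ⟨⟨?_, ?_, h4⟩, by simp, ?_⟩
      · intro t
        obtain ⟨i, hi⟩ := h1 t
        exact ⟨i, fun s' hs' => hi s' (Finset.mem_of_mem_erase hs')⟩
      · rw [Finset.card_erase_add_one h3, h2]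
      · rwa [Finset.insert_erase h3]
    · rintro ⟨τ, x⟩ h
      simp only [D, Finset.mem_sigma, Finset.mem_filter, Finset.mem_univ, true_and] at h
      simp [Finset.erase_insert h.2.1]
    · rintro ⟨σ, x⟩ h
      simp only [R, Finset.mem_sigma, Finset.mem_filter, Finset.mem_univ, true_and] at h
      simp [Finset.insert_erase h.2.1]
  rw [Finset.card_sigma, Finset.card_sigma] at hcount
  have hReven : Even (∑ σ ∈ R, (σ.filter fun x =>
      (σ.erase x).image c = Finset.univ.erase i0).card) := by
    refine Finset.even_sum _ fun σ hσ => ?_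
    simp only [R, Finset.mem_filter, Finset.mem_univ, true_and] at hσ
    rcases Finset.eq_empty_or_nonempty (σ.filter fun x =>
      (σ.erase x).image c = Finset.univ.erase i0) with h | ⟨x, hx⟩
    · rw [h]; simp
    · rw [Finset.mem_filter] at hx
      obtain ⟨hxσ, hx⟩ := hx
      have hcx : c x ≠ i0 := by
        intro h
        apply hcon σ hσ.1 hσ.2
        rw [← Finset.insert_erase hxσ, Finset.image_insert, hx, h]
        exact Finset.insert_erase (Finset.mem_univ _)
      have hci : Set.InjOn c (σ.erase x : Finset V) := by
        apply Finset.card_image_iff.1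
        rw [hx, Finset.card_erase_of_mem (Finset.mem_univ _), Finset.card_erase_of_mem hxσ,
          hσ.2, Finset.card_univ]
      obtain ⟨y, hy, hyx⟩ : ∃ y ∈ σ.erase x, c y = c x := by
        rw [← Finset.mem_image, hx]; simp [hcx]
      have hyσ := Finset.mem_of_mem_erase hy
      have hyne := Finset.ne_of_mem_erase hy
      have : (σ.filter fun x => (σ.erase x).image c = Finset.univ.erase i0) = {x, y} := by
        ext z
        simp only [Finset.mem_filter, Finset.mem_insert, Finset.mem_singleton]
        constructor
        · rintro ⟨hz, hz2⟩
          by_contra hne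
          push Not at hne
          have : c z ∈ (σ.erase z).image c := by
            rw [hz2, ← hx]
            exact Finset.mem_image_of_mem _ (Finset.mem_erase.2 ⟨hne.1, hz⟩)
          obtain ⟨w, hw, hwz⟩ := Finset.mem_image.1 this
          have hwσ := Finset.mem_of_mem_erase hw
          have hwne := Finset.ne_of_mem_erase hw
          by_cases hwx : w = x
          · exact hne.2 (hci (Finset.mem_coe.2 (Finset.mem_erase.2 ⟨hne.1, hz⟩))
              (Finset.mem_coe.2 hy) (by rw [← hwz, hwx, hyx]))
          · exact hwne (hci (Finset.mem_coe.2 (Finset.mem_erase.2 ⟨hwx, hwσ⟩))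
              (Finset.mem_coe.2 (Finset.mem_erase.2 ⟨hne.1, hz⟩)) hwz)
        · rintro (rfl | rfl)
          · exact ⟨hxσ, hx⟩
          · refine ⟨hyσ, ?_⟩
            rw [← hx]
            ext k
            simp only [Finset.mem_image, Finset.mem_erase]
            constructor
            · rintro ⟨w, ⟨hw1, hw2⟩, rfl⟩
              by_cases hwx : w = x
              · exact ⟨z, ⟨hyne, hyσ⟩, by rw [hwx, hyx]⟩
              · exact ⟨w, ⟨hwx, hw2⟩, rfl⟩
            · rintro ⟨w, ⟨hw1, hw2⟩, rfl⟩
              by_cases hwx : w = z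
              · exact ⟨x, ⟨hyne.symm, hxσ⟩, by rw [hwx, hyx]⟩
              · exact ⟨w, ⟨hwx, hw2⟩, rfl⟩
      rw [this, Finset.card_pair hyne.symm]
      exact even_two
  let τ0 : Finset V := (Finset.univ.erase i0).image s
  have hτ0mem : ∀ x, x ∈ τ0 ↔ ∃ k, k ≠ i0 ∧ s k = x := by
    intro x; simp [τ0]
  have hτ0D : τ0 ∈ D := by
    simp only [D, Finset.mem_filter, Finset.mem_univ, true_and]
    refine ⟨?_, ?_, ?_⟩
    · intro t
      by_cases ht : ∀ k, t ≠ s k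
      · refine ⟨i0, fun x hx => ?_⟩
        obtain ⟨k, hk, rfl⟩ := (hτ0mem x).1 hx
        exact (hs2 i0 k t hk ht).le
      · push Not at ht
        obtain ⟨k, rfl⟩ := ht
        refine ⟨k, fun x hx => ?_⟩
        by_cases h : x = s k
        · rw [h]
        · exact (hs1 k x h).le
    · rw [Finset.card_image_of_injective _ hsinj, Finset.card_erase_add_one (Finset.mem_univ _),
        Finset.card_univ]
    · rw [Finset.image_image]
      have : c ∘ s = id := funext hc
      rw [this, Finset.image_id]
  have hDodd : Odd (∑ τ ∈ D, (Finset.univ.filter fun x => x ∉ τ ∧ ScDom v (insert x τ)).card) := by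
    rw [← Finset.add_sum_erase _ _ hτ0D]
    apply Odd.add_even
    · obtain ⟨y, hy, hymax⟩ := Finset.exists_max_image (Finset.univ.filter fun x => x ∉ τ0) (v i0)
        ⟨x0, by
          simp only [Finset.mem_filter, Finset.mem_univ, true_and, hτ0mem]
          rintro ⟨k, -, hk⟩
          exact hx0 k hk.symm⟩
      simp only [Finset.mem_filter, Finset.mem_univ, true_and] at hy hymax
      have hx0τ : x0 ∉ τ0 := by
        rw [hτ0mem]; rintro ⟨k, -, hk⟩; exact hx0 k hk.symm
      have hyT : ∀ k, y ≠ s k := by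
        rintro k rfl
        by_cases hk : k = i0
        · subst hk
          have := hymax x0 hx0τ
          have := hs1 k x0 (hx0 k)
          omega
        · exact hy ((hτ0mem _).2 ⟨k, hk, rfl⟩)
      have : (Finset.univ.filter fun x => x ∉ τ0 ∧ ScDom v (insert x τ0)) = {y} := by
        ext x
        simp only [Finset.mem_filter, Finset.mem_univ, true_and, Finset.mem_singleton]
        constructor
        · rintro ⟨hx, hd⟩
          obtain ⟨i, hi⟩ := hd y
          by_cases hii : i = i0
          · subst hii
            exact hinj i (le_antisymm (hymax x hx) (hi x (by simp)))
          · have := hi (s i) (Finset.mem_insert_of_mem ((hτ0mem _).2 ⟨i, hii, rfl⟩))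
            have := hs1 i y (hyT i)
            omega
        · rintro rfl
          refine ⟨hy, fun t => ?_⟩
          by_cases ht : t ∈ τ0
          · obtain ⟨k, hk, rfl⟩ := (hτ0mem _).1 ht
            refine ⟨k, fun z _ => ?_⟩
            by_cases h : z = s k
            · rw [h]
            · exact (hs1 k z h).le
          · refine ⟨i0, fun z hz => ?_⟩
            rcases Finset.mem_insert.1 hz with rfl | hz
            · exact hymax t ht
            · obtain ⟨k, hk, rfl⟩ := (hτ0mem _).1 hz
              exact (hymax t ht).trans (hs2 i0 k x hk hyT).le
      rw [this]; simp
    · refine Finset.even_sum _ fun τ hτ => ?_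
      obtain ⟨hτne, hτ⟩ := Finset.mem_erase.1 hτ
      simp only [D, Finset.mem_filter, Finset.mem_univ, true_and] at hτ
      obtain ⟨hd, hcard, him⟩ := hτ
      have hcardτ0 : τ0.card = τ.card := by
        simp only [D, Finset.mem_filter, Finset.mem_univ, true_and] at hτ0D
        omega
      refine sc_two_rooms v hinj τ hd ?_ hcard ?_
      · rw [Finset.nonempty_iff_ne_empty]
        rintro rfl
        apply hτne
        rw [Finset.card_empty, Finset.card_eq_zero] at hcardτ0
        exact hcardτ0.symm
      · intro j
        refine ⟨s j, fun i hij => ?_⟩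
        by_contra hno
        push Not at hno
        have h1 : s i ∉ τ := fun h => by
          have := hno _ h
          have := hs1 i (s j) (fun h => hij (hsinj h).symm)
          omega
        have h2 : ∀ x ∈ τ, ∃ k, x = s k := by
          intro x hx
          by_contra h
          push Not at h
          have := hno x hx
          have := hs2 i j x hij.symm h
          omega
        apply hτne
        refine Finset.eq_of_subset_of_card_le ?_ hcardτ0.le
        intro x hx
        obtain ⟨k, rfl⟩ := h2 x hx
        have : c (s k) ∈ τ.image c := Finset.mem_image_of_mem _ hx
        rw [him, hc] at this
        exact (hτ0mem _).2 ⟨k, (Finset.mem_erase.1 this).1, rfl⟩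
  rw [hcount] at hDodd
  exact (Nat.not_even_iff_odd.2 hDodd) hReven

lemma sc_aux_le {x y N r s : ℕ} (hs : s < N) (h : x * N + r ≤ y * N + s) : x ≤ y := by
  by_contra hxy
  push Not at hxy
  have : (y + 1) * N ≤ x * N := Nat.mul_le_mul_right _ hxy
  rw [add_mul] at this
  omega

lemma sc_aux_eq {x y N r s : ℕ} (hr : r < N) (hs : s < N) (h : x * N + r = y * N + s) : r = s := by
  have h1 := sc_aux_le hs h.le
  have h2 := sc_aux_le hr h.ge
  have : x = y := le_antisymm h1 h2
  subst this
  omega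

open Classical in
lemma sc_grid {ι : Type*} [Fintype ι] [Nonempty ι] (k : ℕ) (col : (ι → ℕ) → ι) :
    ∃ a : ι → ℕ, ∑ i, a i = k ∧ ∀ i, a i ≤ Fintype.card ι ∨ ∃ b : ι → ℕ, ∑ i, b i = k ∧
      col b = i ∧ ∀ j, a j ≤ b j + Fintype.card ι ∧ b j ≤ a j + Fintype.card ι := by
  let T := {a : ι → ℕ // a ∈ Finset.piAntidiag (Finset.univ : Finset ι) k}
  have hTsum : ∀ a : T, ∑ i, a.1 i = k := fun a => by
    have := a.2
    rw [Finset.mem_piAntidiag] at this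
    exact this.1
  have hTle : ∀ (a : T) i, a.1 i ≤ k := fun a i => by
    exact (Finset.single_le_sum (f := a.1) (fun _ _ => Nat.zero_le _) (Finset.mem_univ i)).trans (hTsum a).le
  let mkT : ∀ a : ι → ℕ, ∑ i, a i = k → T := fun a ha => ⟨a, by
    rw [Finset.mem_piAntidiag]; exact ⟨ha, fun _ _ => Finset.mem_univ _⟩⟩
  let i0 : ι := Classical.arbitrary ι
  let N := Fintype.card T
  let e : T ≃ Fin N := Fintype.equivFin T
  let e' : ι ≃ Fin (Fintype.card ι) := Fintype.equivFin ι
  let v : ι → T ⊕ ι → ℤ := fun i => Sum.elim (fun a => ((a.1 i * N + (e a).1 : ℕ) : ℤ))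
    (fun j => if j = i then -1 else (((k + 1) * N + (e' j).1 : ℕ) : ℤ))
  have hlt : ∀ (a : T) i, a.1 i * N + (e a).1 < (k + 1) * N := by
    intro a i
    have h1 := (e a).2
    have h2 := Nat.mul_le_mul_right N (hTle a i)
    rw [add_mul]; omega
  have hinj : ∀ i, Function.Injective (v i) := by
    intro i x y hxy
    rcases x with a | j <;> rcases y with b | l <;> simp only [v, Sum.elim_inl, Sum.elim_inr] at hxy
    · have := sc_aux_eq (e a).2 (e b).2 (by exact_mod_cast hxy)
      rw [e.injective (Fin.ext this)]
    · have := hlt a i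
      split_ifs at hxy <;> omega
    · have := hlt b i
      split_ifs at hxy <;> omega
    · by_cases h1 : j = i <;> by_cases h2 : l = i
      · rw [h1, h2]
      · rw [if_pos h1, if_neg h2] at hxy; omega
      · rw [if_neg h1, if_pos h2] at hxy; omega
      · rw [if_neg h1, if_neg h2] at hxy
        have : (e' j).1 = (e' l).1 := by
          have : (k + 1) * N + (e' j).1 = (k + 1) * N + (e' l).1 := by exact_mod_cast hxy
          omega
        rw [e'.injective (Fin.ext this)]
  let c : T ⊕ ι → ι := Sum.elim (fun a => col a.1) id
  obtain ⟨σ, hd, hcard, him⟩ := sc_scarf v hinj Sum.inr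
    (by
      intro i x hx
      rcases x with a | j <;> simp only [v, Sum.elim_inl, Sum.elim_inr, if_true]
      · omega
      · have : j ≠ i := fun h => hx (by rw [h])
        rw [if_neg this]; omega)
    (by
      intro i j x hj hx
      rcases x with a | l
      · simp only [v, Sum.elim_inl, Sum.elim_inr, if_neg hj]
        exact_mod_cast (hlt a i).trans_le (Nat.le_add_right _ _)
      · exact absurd rfl (hx l))
    (Sum.inl (mkT (Pi.single i0 k) (by simp))) (by simp) c (fun i => rfl) i0
  have hC : ∀ t : T, ∃ i, Sum.inr i ∉ σ ∧ ∀ a : T, Sum.inl a ∈ σ → t.1 i ≤ a.1 i := by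
    intro t
    obtain ⟨i, hi⟩ := hd (Sum.inl t)
    refine ⟨i, fun h => ?_, fun a ha => ?_⟩
    · have := hi _ h
      simp only [v, Sum.elim_inl, Sum.elim_inr, if_true] at this
      omega
    · have := hi _ ha
      simp only [v, Sum.elim_inl] at this
      exact sc_aux_le (e a).2 (by exact_mod_cast this)
  have hcol : ∀ i, Sum.inr i ∉ σ → ∃ a : T, Sum.inl a ∈ σ ∧ col a.1 = i := by
    intro i hi
    have : i ∈ σ.image c := by rw [him]; exact Finset.mem_univ _
    obtain ⟨x, hx, hxi⟩ := Finset.mem_image.1 this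
    rcases x with a | j
    · exact ⟨a, hx, hxi⟩
    · have : j = i := hxi
      exact absurd (this ▸ hx) hi
  obtain ⟨j0, hj0, -⟩ := hC (mkT (Pi.single i0 k) (by simp))
  obtain ⟨a0, ha0, -⟩ := hcol j0 hj0
  -- minima
  let S : Finset T := Finset.univ.filter fun a => Sum.inl a ∈ σ
  have hS : ∀ a, a ∈ S ↔ Sum.inl a ∈ σ := fun a => by simp [S]
  have hmin : ∀ i, ∃ a ∈ S, ∀ b ∈ S, a.1 i ≤ b.1 i := fun i =>
    Finset.exists_min_image S (fun a => a.1 i) ⟨a0, (hS _).2 ha0⟩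
  choose mm hmmS hmm using hmin
  let m : ι → ℕ := fun i => if Sum.inr i ∈ σ then 0 else (mm i).1 i + 1
  have hsum : k < ∑ i, m i := by
    by_contra hcon
    push Not at hcon
    let t : ι → ℕ := m + Pi.single i0 (k - ∑ i, m i)
    have ht : ∑ i, t i = k := by
      simp only [t, Pi.add_apply, Finset.sum_add_distrib]
      simp; omega
    obtain ⟨i, hi, hti⟩ := hC (mkT t ht)
    have h1 := hti _ ((hS _).1 (hmmS i))
    have h2 : m i ≤ t i := by simp [t]
    have h3 : m i = (mm i).1 i + 1 := by simp [m, hi]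
    have h4 : (mkT t ht).1 i = t i := rfl
    omega
  have hbd : ∀ a ∈ S, ∀ i, a.1 i + 1 ≤ m i + Fintype.card ι := by
    intro a ha i
    have h1 : ∀ j, m j ≤ a.1 j + 1 := by
      intro j
      simp only [m]
      split_ifs
      · omega
      · have := hmm j a ha; omega
    have h2 : ∑ j ∈ Finset.univ.erase i, m j ≤ ∑ j ∈ Finset.univ.erase i, (a.1 j + 1) :=
      Finset.sum_le_sum fun j _ => h1 j
    rw [Finset.sum_add_distrib, Finset.sum_const, Finset.card_erase_of_mem (Finset.mem_univ _),
      Finset.card_univ, smul_eq_mul, mul_one] at h2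
    have h3 := Finset.add_sum_erase Finset.univ m (Finset.mem_univ i)
    have h4 := Finset.add_sum_erase Finset.univ a.1 (Finset.mem_univ i)
    have h5 := hTsum a
    have h6 : 0 < Fintype.card ι := Fintype.card_pos
    omega
  have hclose : ∀ a ∈ S, ∀ b ∈ S, ∀ j, a.1 j ≤ b.1 j + Fintype.card ι := by
    intro a ha b hb j
    have h1 := hbd a ha j
    have h2 : m j ≤ b.1 j + 1 := by
      simp only [m]
      split_ifs
      · omega
      · have := hmm j b hb; omega
    omega
  have ha0S := (hS _).2 ha0
  refine ⟨a0.1, hTsum a0, fun i => ?_⟩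
  by_cases hi : Sum.inr i ∈ σ
  · left
    have := hbd a0 ha0S i
    simp only [m, if_pos hi] at this
    omega
  · right
    obtain ⟨b, hb, hbi⟩ := hcol i hi
    have hbS := (hS _).2 hb
    exact ⟨b.1, hTsum b, hbi, fun j => ⟨hclose _ ha0S _ hbS j, hclose _ hbS _ ha0S j⟩⟩

open Classical in
lemma sc_brouwer {ι : Type*} [Fintype ι] [Nonempty ι] (f : (ι → ℝ) → (ι → ℝ))
    (hf : ContinuousOn f (stdSimplex ℝ ι)) (hm : Set.MapsTo f (stdSimplex ℝ ι) (stdSimplex ℝ ι)) :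
    ∃ y ∈ stdSimplex ℝ ι, f y = y := by
  have happ : ∀ ε > 0, ∃ y ∈ stdSimplex ℝ ι, ∀ i, y i - f y i ≤ ε := by
    intro ε hε
    have huc := (isCompact_stdSimplex ℝ ι).uniformContinuousOn_of_continuous hf
    rw [Metric.uniformContinuousOn_iff] at huc
    obtain ⟨δ, hδ, huc⟩ := huc (ε / 2) (by positivity)
    set n : ℝ := (Fintype.card ι : ℝ) with hn
    have hn0 : 0 ≤ n := by positivity
    obtain ⟨k, hk⟩ := exists_nat_gt (max 1 (n / (min δ (ε / 2))))
    have hk1 : (1 : ℝ) < k := (le_max_left _ _).trans_lt hk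
    have hk0 : (0 : ℝ) < k := by linarith
    have hmn : 0 < min δ (ε / 2) := lt_min hδ (by positivity)
    have hk2 : n / k < min δ (ε / 2) := by
      have := (le_max_right _ _).trans_lt hk
      rw [div_lt_iff₀ hmn] at this
      rw [div_lt_iff₀ hk0]; linarith
    let pt : (ι → ℕ) → ι → ℝ := fun a i => (a i : ℝ) / k
    have hpt : ∀ a : ι → ℕ, ∑ i, a i = k → pt a ∈ stdSimplex ℝ ι := by
      intro a ha
      refine ⟨fun i => by simp only [pt]; positivity, ?_⟩
      simp only [pt]
      rw [← Finset.sum_div, ← Nat.cast_sum, ha, div_self hk0.ne']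
    have hcol : ∀ a : ι → ℕ, ∃ i, ∑ i, a i = k → pt a i ≤ f (pt a) i := by
      intro a
      by_cases ha : ∑ i, a i = k
      · by_contra hcon
        push Not at hcon
        have h1 : ∑ i, f (pt a) i < ∑ i, pt a i :=
          Finset.sum_lt_sum_of_nonempty Finset.univ_nonempty fun i _ => (hcon i).2
        rw [(hm (hpt a ha)).2, (hpt a ha).2] at h1
        exact lt_irrefl _ h1
      · exact ⟨Classical.arbitrary ι, fun h => absurd h ha⟩
    choose col hcol using hcol
    obtain ⟨a, ha, hab⟩ := sc_grid k col
    refine ⟨pt a, hpt a ha, fun i => ?_⟩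
    rcases hab i with h | ⟨b, hb, hbi, hcl⟩
    · have h1 : pt a i ≤ n / k := by
        simp only [pt]
        gcongr
        rw [hn]; exact_mod_cast h
      have h2 := (hm (hpt a ha)).1 i
      have h3 := min_le_right δ (ε / 2)
      linarith
    · have hd : ∀ j, |pt a j - pt b j| ≤ n / k := by
        intro j
        simp only [pt]
        rw [← sub_div, abs_div, abs_of_pos hk0]
        gcongr
        have h1 : (a j : ℝ) ≤ b j + n := by rw [hn]; exact_mod_cast (hcl j).1
        have h2 : (b j : ℝ) ≤ a j + n := by rw [hn]; exact_mod_cast (hcl j).2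
        rw [abs_le]; constructor <;> linarith
      have hdist : dist (pt a) (pt b) < δ := by
        refine lt_of_le_of_lt ((dist_pi_le_iff (by positivity)).2 fun j => ?_)
          (hk2.trans_le (min_le_left _ _))
        exact hd j
      have h1 := huc _ (hpt a ha) _ (hpt b hb) hdist
      have h2 := (dist_le_pi_dist (f (pt a)) (f (pt b)) i).trans_lt h1
      rw [Real.dist_eq, abs_lt] at h2
      have h3 := hcol b hb
      rw [hbi] at h3
      have h4 := (abs_le.1 (hd i)).2
      have h5 := min_le_right δ (ε / 2)
      linarith
  have hcont : ContinuousOn (fun y => Finset.univ.sup' Finset.univ_nonempty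
      fun i => y i - f y i) (stdSimplex ℝ ι) := by
    refine ContinuousOn.finset_sup'_apply _ fun i _ => ?_
    exact (continuous_apply i).continuousOn.sub ((continuous_apply i).comp_continuousOn hf)
  obtain ⟨y, hy, hymin⟩ := (isCompact_stdSimplex ℝ ι).exists_isMinOn
    (by obtain ⟨y, hy, -⟩ := happ 1 one_pos; exact ⟨y, hy⟩) hcont
  have hle : ∀ i, y i ≤ f y i := by
    intro i
    refine le_of_forall_pos_le_add fun ε hε => ?_
    obtain ⟨z, hz, hzε⟩ := happ ε hε
    have h1 := isMinOn_iff.1 hymin z hz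
    have h2 : y i - f y i ≤ Finset.univ.sup' Finset.univ_nonempty fun i => y i - f y i :=
      Finset.le_sup' (fun i => y i - f y i) (Finset.mem_univ i)
    have h3 : (Finset.univ.sup' Finset.univ_nonempty fun i => z i - f z i) ≤ ε :=
      Finset.sup'_le _ _ fun i _ => hzε i
    linarith
  refine ⟨y, hy, funext fun i => ?_⟩
  have hs : ∑ i, y i = ∑ i, f y i := by rw [hy.2, (hm hy).2]
  exact ((Finset.sum_eq_sum_iff_of_le fun i _ => hle i).1 hs i (Finset.mem_univ i)).symm

lemma sc_cone {d : ℕ} (hd : 0 < d) (T : (Fin d → ℝ) → (Fin d → ℝ))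
    (hT : ContinuousOn T {x | ∀ k, 0 ≤ x k}) (hT0 : ∀ x, (∀ k, 0 ≤ x k) → ∀ k, 0 ≤ T x k)
    (a b : ℝ) (ha : 0 < a) (hab : a < b)
    (h1 : ∀ x : Fin d → ℝ, (∀ k, 0 ≤ x k) → ∑ k, x k = a → ¬ ∀ k, x k ≤ T x k)
    (h2 : ∀ x : Fin d → ℝ, (∀ k, 0 ≤ x k) → ∑ k, x k = b → ¬ ∀ k, T x k ≤ x k) :
    ∃ x : Fin d → ℝ, (∀ k, 0 ≤ x k) ∧ a ≤ ∑ k, x k ∧ ∑ k, x k ≤ b ∧ T x = x := by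
  have hb : 0 < b := ha.trans hab
  have hd' : (0 : ℝ) < d := by exact_mod_cast hd
  let x : (Option (Fin d) → ℝ) → Fin d → ℝ := fun y k =>
    b * y (some k) + max 0 (a - ∑ j, b * y (some j)) / d
  let s : (Option (Fin d) → ℝ) → ℝ := fun y => ∑ k, T (x y) k
  let r : (Option (Fin d) → ℝ) → ℝ := fun y => ∑ k, x y k
  let r' : (Option (Fin d) → ℝ) → ℝ := fun y => max a (min b (2 * r y - s y))
  let z : (Option (Fin d) → ℝ) → Fin d → ℝ := fun y k =>
    r' y * ((x y k / r y + T (x y) k) / (1 + s y))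
  let F : (Option (Fin d) → ℝ) → Option (Fin d) → ℝ := fun y o =>
    o.elim (1 - r' y / b) (fun k => z y k / b)
  have hx0 : ∀ y ∈ stdSimplex ℝ (Option (Fin d)), ∀ k, 0 ≤ x y k := by
    intro y hy k
    have := hy.1 (some k)
    simp only [x]
    positivity
  have hr : ∀ y, r y = max (∑ j, b * y (some j)) a := by
    intro y
    simp only [r, x, Finset.sum_add_distrib, Finset.sum_const, Finset.card_univ, Fintype.card_fin,
      nsmul_eq_mul]
    rw [mul_div_cancel₀ _ hd'.ne']
    rcases le_total (∑ j, b * y (some j)) a with h | h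
    · rw [max_eq_right h, max_eq_right (by linarith)]; ring
    · rw [max_eq_left h, max_eq_left (by linarith)]; ring
  have hrpos : ∀ y, 0 < r y := fun y => by rw [hr]; exact lt_max_of_lt_right ha
  have hs0 : ∀ y ∈ stdSimplex ℝ (Option (Fin d)), 0 ≤ s y := fun y hy =>
    Finset.sum_nonneg fun k _ => hT0 _ (hx0 y hy) k
  have hr'a : ∀ y, a ≤ r' y := fun y => le_max_left _ _
  have hr'b : ∀ y, r' y ≤ b := fun y => max_le hab.le (min_le_left _ _)
  have hzsum : ∀ y ∈ stdSimplex ℝ (Option (Fin d)), ∑ k, z y k = r' y := by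
    intro y hy
    have h1 := hs0 y hy
    have : ∑ k, x y k = r y := rfl
    have h3 : ∑ k, T (x y) k = s y := rfl
    simp only [z]
    rw [← Finset.mul_sum, ← Finset.sum_div, Finset.sum_add_distrib, ← Finset.sum_div, this, h3,
      div_self (hrpos y).ne', div_self (by linarith), mul_one]
  have hxc : Continuous x := by
    refine continuous_pi fun k => ?_
    simp only [x]
    fun_prop
  have hrc : Continuous r := by
    simp only [r]
    exact continuous_finsetSum _ fun k _ => (continuous_apply k).comp hxc
  have hTc : ContinuousOn (fun y => T (x y)) (stdSimplex ℝ (Option (Fin d))) :=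
    hT.comp hxc.continuousOn fun y hy => hx0 y hy
  have hTk : ∀ k, ContinuousOn (fun y => T (x y) k) (stdSimplex ℝ (Option (Fin d))) :=
    fun k => (continuous_apply k).comp_continuousOn hTc
  have hsc : ContinuousOn s (stdSimplex ℝ (Option (Fin d))) :=
    continuousOn_finsetSum _ fun k _ => hTk k
  have hr'c : ContinuousOn r' (stdSimplex ℝ (Option (Fin d))) :=
    continuousOn_const.sup (continuousOn_const.inf ((continuousOn_const.mul hrc.continuousOn).sub hsc))
  have hFc : ContinuousOn F (stdSimplex ℝ (Option (Fin d))) := by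
    refine continuousOn_pi.2 fun o => ?_
    rcases o with _ | k
    · exact continuousOn_const.sub (hr'c.div_const _)
    · refine ContinuousOn.div_const (hr'c.mul (ContinuousOn.div (ContinuousOn.add
        (ContinuousOn.div ((continuous_apply k).comp hxc).continuousOn hrc.continuousOn
          fun y _ => (hrpos y).ne') (hTk k)) (continuousOn_const.add hsc) ?_)) _
      intro y hy
      have := hs0 y hy
      exact (by linarith : (0 : ℝ) < 1 + s y).ne'
  have hFm : Set.MapsTo F (stdSimplex ℝ (Option (Fin d))) (stdSimplex ℝ (Option (Fin d))) := by
    intro y hy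
    refine ⟨fun o => ?_, ?_⟩
    · rcases o with _ | k
      · simp only [F, Option.elim]
        rw [sub_nonneg, div_le_one hb]; exact hr'b y
      · simp only [F, Option.elim, z]
        have := hs0 y hy
        have := hrpos y
        have := hx0 y hy k
        have := hT0 _ (hx0 y hy) k
        have := ha.le.trans (hr'a y)
        positivity
    · rw [Fintype.sum_option]
      simp only [F, Option.elim]
      rw [← Finset.sum_div, hzsum y hy]; ring
  obtain ⟨y, hy, hfix⟩ := sc_brouwer F hFc hFm
  have hzk : ∀ k, b * y (some k) = z y k := by
    intro k
    have := congrFun hfix (some k)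
    simp only [F, Option.elim] at this
    rw [← this]; field_simp
  have hsum : ∑ j, b * y (some j) = r' y := by
    rw [← hzsum y hy]; exact Finset.sum_congr rfl fun k _ => hzk k
  have hrr : r y = r' y := by rw [hr, hsum]; exact max_eq_left (hr'a y)
  have hxz : ∀ k, x y k = z y k := by
    intro k
    rw [← hzk k]
    simp only [x]
    rw [hsum, max_eq_left (by linarith [hr'a y])]; simp
  have hmain : ∀ k, x y k * s y = r y * T (x y) k := by
    intro k
    have h := hxz k
    simp only [z] at h
    rw [← hrr] at h
    have h0 := hrpos y
    have h3 : 0 < 1 + s y := by linarith [hs0 y hy]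
    have e : r y * ((x y k / r y + T (x y) k) / (1 + s y))
        = (x y k + r y * T (x y) k) / (1 + s y) := by
      field_simp
    rw [e, eq_div_iff h3.ne'] at h
    linarith
  have hrsum : ∑ k, x y k = r y := rfl
  have hrdef : r' y = max a (min b (2 * r y - s y)) := rfl
  refine ⟨x y, hx0 y hy, by rw [hrsum, hrr]; exact hr'a y, by rw [hrsum, hrr]; exact hr'b y, ?_⟩
  have hrs : s y = r y := by
    by_contra hne
    rcases lt_or_gt_of_ne hne with hlt | hgt
    · have hrb : r y = b := by
        by_contra hrb
        have h4 : r y < b := lt_of_le_of_ne (hrr ▸ hr'b y) hrb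
        have : r y < r' y := by
          rw [hrdef]
          exact lt_max_of_lt_right (lt_min h4 (by linarith))
        linarith
      refine h2 _ (hx0 y hy) hrb fun k => ?_
      have := hmain k
      have h5 := hx0 y hy k
      have h0 := hrpos y
      have : r y * T (x y) k ≤ r y * x y k := by
        rw [← this, mul_comm (r y)]
        exact mul_le_mul_of_nonneg_left hlt.le h5
      exact le_of_mul_le_mul_left this h0
    · have hra : r y = a := by
        by_contra hra
        have h4 : a < r y := lt_of_le_of_ne (hrr ▸ hr'a y) (Ne.symm hra)
        have : r' y < r y := by
          rw [hrdef]
          exact max_lt h4 ((min_le_right _ _).trans_lt (by linarith))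
        linarith
      refine h1 _ (hx0 y hy) hra fun k => ?_
      have := hmain k
      have h5 := hx0 y hy k
      have h0 := hrpos y
      have : r y * x y k ≤ r y * T (x y) k := by
        rw [← this, mul_comm (r y)]
        exact mul_le_mul_of_nonneg_left hgt.le h5
      exact le_of_mul_le_mul_left this h0
  funext k
  have := hmain k
  rw [hrs, mul_comm] at this
  exact (mul_left_cancel₀ (hrpos y).ne' this).symm

lemma sc_pow {d : ℕ} (hd : 0 < d) (M : Matrix (Fin d) (Fin d) ℝ)
    (h : ∀ μ ∈ spectrum ℂ (M.map Complex.ofReal), ‖μ‖ < 1) (ε : ℝ) (hε : 0 < ε) :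
    ∃ n : ℕ, ∀ k j, |(M ^ n) k j| < ε := by
  let _ := Matrix.linftyOpNormedRing (n := Fin d) (α := ℂ)
  let _ := Matrix.linftyOpNormedAlgebra (n := Fin d) (R := ℂ) (α := ℂ)
  have : Nonempty (Fin d) := ⟨⟨0, hd⟩⟩
  have : CompleteSpace (Matrix (Fin d) (Fin d) ℂ) := FiniteDimensional.complete ℂ _
  set A : Matrix (Fin d) (Fin d) ℂ := M.map Complex.ofReal with hA
  have hr : spectralRadius ℂ A < (1 : NNReal) :=
    spectrum.spectralRadius_lt_of_forall_lt A fun k hk => by exact_mod_cast h k hk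
  obtain ⟨r, hr1, hr2⟩ := ENNReal.lt_iff_exists_nnreal_btwn.1 hr
  have hr2' : r < 1 := by exact_mod_cast hr2
  have ht := spectrum.pow_nnnorm_pow_one_div_tendsto_nhds_spectralRadius A
  have ev := ht.eventually_lt_const hr1
  have ev2 : ∀ᶠ n : ℕ in atTop, (r : ℝ) ^ n < ε :=
    (tendsto_pow_atTop_nhds_zero_of_lt_one r.2 (by exact_mod_cast hr2')).eventually_lt_const hε
  obtain ⟨n, hn1, hn2, hn0⟩ := (ev.and (ev2.and (eventually_gt_atTop 0))).exists
  refine ⟨n, fun k j => ?_⟩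
  have hn0' : (0 : ℝ) < n := by exact_mod_cast hn0
  have hle : (‖A ^ n‖₊ : ℝ≥0∞) ≤ (r : ℝ≥0∞) ^ n := by
    have := ENNReal.rpow_le_rpow hn1.le hn0'.le
    rw [← ENNReal.rpow_mul, one_div, inv_mul_cancel₀ hn0'.ne', ENNReal.rpow_one,
      ENNReal.rpow_natCast] at this
    exact this
  have hle' : ‖A ^ n‖₊ ≤ r ^ n := by exact_mod_cast hle
  have hent : ‖(A ^ n) k j‖₊ ≤ ‖A ^ n‖₊ := by
    rw [Matrix.linfty_opNNNorm_def]
    refine le_trans ?_ (Finset.le_sup (Finset.mem_univ k))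
    exact Finset.single_le_sum (f := fun j => ‖(A ^ n) k j‖₊) (fun _ _ => zero_le) (Finset.mem_univ j)
  have hmap : (A ^ n) k j = (((M ^ n) k j : ℝ) : ℂ) := by
    have : A ^ n = (M ^ n).map Complex.ofReal := by
      rw [hA]
      exact (map_pow (Complex.ofRealHom.mapMatrix) M n).symm
    rw [this]; rfl
  have h3 : ‖(A ^ n) k j‖ ≤ (r : ℝ) ^ n := by exact_mod_cast hent.trans hle'
  rw [hmap, Complex.norm_real, Real.norm_eq_abs] at h3
  exact h3.trans_lt hn2

lemma sc_mat {d : ℕ} (hd : 0 < d) (M : Matrix (Fin d) (Fin d) ℝ) (hM : ∀ k j, 0 ≤ M k j)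
    (h : ∀ μ ∈ spectrum ℂ (M.map Complex.ofReal), ‖μ‖ < 1) :
    ∃ δ > 0, ∀ y : Fin d → ℝ, (∀ k, 0 ≤ y k) → ∑ k, y k = 1 →
      ¬ ∀ k, y k ≤ ∑ j, M k j * y j + δ := by
  have hd' : (0 : ℝ) < d := by exact_mod_cast hd
  obtain ⟨n, hn⟩ := sc_pow hd M h (1 / (2 * d)) (by positivity)
  have hMi : ∀ i : ℕ, ∀ k j, 0 ≤ (M ^ i) k j := by
    intro i
    induction i with
    | zero => intro k j; rw [pow_zero, Matrix.one_apply]; split_ifs <;> norm_num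
    | succ i ih =>
      intro k j
      rw [pow_succ, Matrix.mul_apply]
      exact Finset.sum_nonneg fun l _ => mul_nonneg (ih k l) (hM l j)
  set W : Matrix (Fin d) (Fin d) ℝ := ∑ i ∈ Finset.range n, M ^ i with hW
  have hW0 : ∀ k j, 0 ≤ W k j := by
    intro k j
    rw [hW, Matrix.sum_apply]
    exact Finset.sum_nonneg fun i _ => hMi i k j
  set K : ℝ := ∑ k, ∑ j, W k j with hK
  have hK0 : 0 ≤ K := Finset.sum_nonneg fun k _ => Finset.sum_nonneg fun j _ => hW0 k j
  refine ⟨1 / (4 * (K + 1)), by positivity, fun y hy hsum hcon => ?_⟩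
  set δ := 1 / (4 * (K + 1)) with hδ
  have e1 : W.mulVec ((1 - M).mulVec y) = y - (M ^ n).mulVec y := by
    rw [Matrix.mulVec_mulVec, hW, geom_sum_mul_neg, Matrix.sub_mulVec, Matrix.one_mulVec]
  have h1 : ∀ k, (1 - M).mulVec y k ≤ δ := by
    intro k
    rw [Matrix.sub_mulVec, Matrix.one_mulVec, Pi.sub_apply, Matrix.mulVec, dotProduct]
    linarith [hcon k]
  have h2 : ∑ k, (W.mulVec ((1 - M).mulVec y)) k ≤ K * δ := by
    rw [hK, Finset.sum_mul]
    refine Finset.sum_le_sum fun k _ => ?_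
    rw [Matrix.mulVec, dotProduct, Finset.sum_mul]
    exact Finset.sum_le_sum fun j _ => mul_le_mul_of_nonneg_left (h1 j) (hW0 k j)
  have h3 : ∑ k, (M ^ n).mulVec y k ≤ 1 / 2 := by
    have : ∀ k, (M ^ n).mulVec y k ≤ 1 / (2 * d) := by
      intro k
      rw [Matrix.mulVec, dotProduct]
      calc ∑ j, (M ^ n) k j * y j ≤ ∑ j, 1 / (2 * (d : ℝ)) * y j :=
            Finset.sum_le_sum fun j _ => mul_le_mul_of_nonneg_right
              ((le_abs_self _).trans (hn k j).le) (hy j)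
        _ = 1 / (2 * d) := by rw [← Finset.mul_sum, hsum, mul_one]
    calc ∑ k, (M ^ n).mulVec y k ≤ ∑ k : Fin d, 1 / (2 * (d : ℝ)) :=
          Finset.sum_le_sum fun k _ => this k
      _ = 1 / 2 := by
        rw [Finset.sum_const, Finset.card_univ, Fintype.card_fin, nsmul_eq_mul]; field_simp
  rw [e1] at h2
  simp only [Pi.sub_apply, Finset.sum_sub_distrib] at h2
  have h4 : K * δ < 1 / 2 := by
    rw [hδ, mul_one_div, div_lt_div_iff₀ (by positivity) (by norm_num)]; linarith
  linarith

lemma sc_poly_mul {t A S Q A' S' Q' : ℝ} (ht0 : 0 ≤ t) (ht1 : t ≤ 1)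
    (h : 0 ≤ A ∧ 0 ≤ S ∧ 1 + S ≤ Q ∧ A ≤ 1 + t * S + t ^ 2 * (Q - 1 - S))
    (h' : 0 ≤ A' ∧ 0 ≤ S' ∧ 1 + S' ≤ Q' ∧ A' ≤ 1 + t * S' + t ^ 2 * (Q' - 1 - S')) :
    0 ≤ A * A' ∧ 0 ≤ S + S' ∧ 1 + (S + S') ≤ Q * Q' ∧
      A * A' ≤ 1 + t * (S + S') + t ^ 2 * (Q * Q' - 1 - (S + S')) := by
  obtain ⟨hA, hS, hQ, hb⟩ := h
  obtain ⟨hA', hS', hQ', hb'⟩ := h'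
  obtain ⟨R, hR⟩ : ∃ R, R = Q - 1 - S := ⟨_, rfl⟩
  obtain ⟨R', hR'⟩ : ∃ R', R' = Q' - 1 - S' := ⟨_, rfl⟩
  have hR0 : 0 ≤ R := by linarith
  have hR0' : 0 ≤ R' := by linarith
  have eQ : Q = 1 + S + R := by linarith
  have eQ' : Q' = 1 + S' + R' := by linarith
  rw [← hR] at hb
  rw [← hR'] at hb'
  have p1 := mul_nonneg hS hS'
  have p2 := mul_nonneg hS hR0'
  have p3 := mul_nonneg hR0 hS'
  have p4 := mul_nonneg hR0 hR0'
  refine ⟨mul_nonneg hA hA', add_nonneg hS hS', by rw [eQ, eQ']; nlinarith, ?_⟩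
  have hm : A * A' ≤ (1 + t * S + t ^ 2 * R) * (1 + t * S' + t ^ 2 * R') :=
    mul_le_mul hb hb' hA' (hA.trans hb)
  refine hm.trans ?_
  have e3 : t ^ 3 ≤ t ^ 2 := pow_le_pow_of_le_one ht0 ht1 (by norm_num)
  have e4 : t ^ 4 ≤ t ^ 2 := pow_le_pow_of_le_one ht0 ht1 (by norm_num)
  have q2 := mul_le_mul_of_nonneg_right e3 p2
  have q3 := mul_le_mul_of_nonneg_right e3 p3
  have q4 := mul_le_mul_of_nonneg_right e4 p4
  rw [eQ, eQ']
  nlinarith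

lemma sc_poly {d : ℕ} (t : ℝ) (ht0 : 0 ≤ t) (ht1 : t ≤ 1) (z : Fin d → ℝ) (hz : ∀ j, 0 ≤ z j)
    (n : Fin d → ℕ) : ∏ j, (1 + t * z j) ^ n j ≤
      1 + t * ∑ j, n j * z j + t ^ 2 * ∏ j, (1 + z j) ^ n j := by
  have hp : ∀ (w : ℝ), 0 ≤ w → ∀ m : ℕ, 0 ≤ (1 + t * w) ^ m ∧ 0 ≤ m * w ∧ 1 + m * w ≤ (1 + w) ^ m ∧
      (1 + t * w) ^ m ≤ 1 + t * (m * w) + t ^ 2 * ((1 + w) ^ m - 1 - m * w) := by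
    intro w hw m
    induction m with
    | zero => simp
    | succ m ih =>
      have := sc_poly_mul ht0 ht1 ih (A' := 1 + t * w) (S' := w) (Q' := 1 + w)
        ⟨by positivity, hw, le_rfl, by simp⟩
      rw [pow_succ, pow_succ]
      push_cast
      rw [add_mul, one_mul]
      exact this
  have hall : ∀ s : Finset (Fin d), 0 ≤ ∏ j ∈ s, (1 + t * z j) ^ n j ∧ 0 ≤ ∑ j ∈ s, n j * z j ∧
      1 + ∑ j ∈ s, n j * z j ≤ ∏ j ∈ s, (1 + z j) ^ n j ∧ ∏ j ∈ s, (1 + t * z j) ^ n j ≤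
        1 + t * ∑ j ∈ s, n j * z j + t ^ 2 * (∏ j ∈ s, (1 + z j) ^ n j - 1 - ∑ j ∈ s, n j * z j) := by
    intro s
    induction s using Finset.induction_on with
    | empty => simp
    | insert j s hj ih =>
      rw [Finset.prod_insert hj, Finset.sum_insert hj, Finset.prod_insert hj]
      exact sc_poly_mul ht0 ht1 (hp (z j) (hz j) (n j)) ih
  obtain ⟨-, h1, h2, h3⟩ := hall Finset.univ
  refine h3.trans ?_
  have : t ^ 2 * (∏ j, (1 + z j) ^ n j - 1 - ∑ j, n j * z j) ≤ t ^ 2 * ∏ j, (1 + z j) ^ n j :=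
    mul_le_mul_of_nonneg_left (by linarith) (by positivity)
  linarith

noncomputable def scQ {d : ℕ} (x : Fin d → ℝ) : Fin d → ℝ≥0∞ := fun j => ENNReal.ofReal (1 + x j)

lemma sc_prod {d : ℕ} (x : Fin d → ℝ) (hx : ∀ k, 0 ≤ x k) (n : Fin d → ℕ) :
    ∏ j, (scQ x j) ^ n j = ENNReal.ofReal (∏ j, (1 + x j) ^ n j) := by
  rw [ENNReal.ofReal_prod_of_nonneg fun j _ => by have := hx j; positivity]
  refine Finset.prod_congr rfl fun j _ => ?_
  rw [scQ, ENNReal.ofReal_pow (by have := hx j; positivity)]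

lemma sc_meas {d : ℕ} {Ω : Type*} [MeasurableSpace Ω] (Y : Ω → Fin d → ℕ) (hY : Measurable Y)
    (q : Fin d → ℝ≥0∞) : Measurable fun ω => ∏ j, (q j) ^ (Y ω j) := by
  refine Finset.measurable_fun_prod _ fun j _ => ?_
  exact (measurable_of_countable fun n : ℕ => q j ^ n).comp ((measurable_pi_apply j).comp hY)

lemma sc_quad {d : ℕ} {Ω : Type*} [MeasurableSpace Ω]
    (P : Fin d → Measure Ω) (X : ℕ → Ω → Fin d → ℕ)
    (hprob : ∀ k, IsProbabilityMeasure (P k)) (hmeas : ∀ n, Measurable (X n))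
    (hfin : ∀ k j, ∫⁻ ω, (X 1 ω j : ℝ≥0∞) ∂ (P k) ≠ ⊤)
    (t : ℝ) (ht0 : 0 ≤ t) (ht1 : t ≤ 1) (z : Fin d → ℝ) (hz : ∀ j, 0 ≤ z j) (k : Fin d)
    (C : ℝ) (hC0 : 0 ≤ C) (hC : genFun P X 1 (scQ z) k ≤ ENNReal.ofReal C) :
    genFun P X 1 (scQ (fun j => t * z j)) k ≤
      ENNReal.ofReal (1 + t * ∑ j, meanMatrix P X k j * z j + t ^ 2 * C) := by
  have := hprob k
  have hM : ∀ j, 0 ≤ meanMatrix P X k j := fun j => ENNReal.toReal_nonneg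
  have hXm : ∀ j, Measurable fun ω => (X 1 ω j : ℝ≥0∞) := fun j =>
    (measurable_of_countable fun n : ℕ => (n : ℝ≥0∞)).comp ((measurable_pi_apply j).comp (hmeas 1))
  calc genFun P X 1 (scQ (fun j => t * z j)) k
      ≤ ∫⁻ ω, (1 + ∑ j, ENNReal.ofReal (t * z j) * (X 1 ω j : ℝ≥0∞)
          + ENNReal.ofReal (t ^ 2) * ∏ j, (scQ z j) ^ (X 1 ω j)) ∂ (P k) := by
        refine lintegral_mono fun ω => ?_
        dsimp only
        rw [sc_prod _ (fun j => mul_nonneg ht0 (hz j)), sc_prod _ hz]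
        refine (ENNReal.ofReal_le_ofReal (sc_poly t ht0 ht1 z hz (X 1 ω))).trans ?_
        have hS : 0 ≤ ∑ j, (X 1 ω j : ℝ) * z j :=
          Finset.sum_nonneg fun j _ => mul_nonneg (Nat.cast_nonneg _) (hz j)
        have hQ : 0 ≤ ∏ j, (1 + z j) ^ (X 1 ω j) :=
          Finset.prod_nonneg fun j _ => by have := hz j; positivity
        rw [ENNReal.ofReal_add (by positivity) (by positivity),
          ENNReal.ofReal_add (by positivity) (by positivity), ENNReal.ofReal_one,
          ENNReal.ofReal_mul (by positivity : (0 : ℝ) ≤ t ^ 2), Finset.mul_sum,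
          ENNReal.ofReal_sum_of_nonneg (fun j _ => by have := hz j; positivity)]
        refine le_of_eq ?_
        congr 2
        refine Finset.sum_congr rfl fun j _ => ?_
        rw [← ENNReal.ofReal_natCast (X 1 ω j), ← ENNReal.ofReal_mul (mul_nonneg ht0 (hz j))]
        congr 1; ring
    _ = 1 + ∑ j, ENNReal.ofReal (t * z j) * (∫⁻ ω, (X 1 ω j : ℝ≥0∞) ∂ (P k))
          + ENNReal.ofReal (t ^ 2) * genFun P X 1 (scQ z) k := by
        rw [lintegral_add_right _ ((sc_meas _ (hmeas 1) _).const_mul _),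
          lintegral_add_left measurable_const, lintegral_const_mul _ (sc_meas _ (hmeas 1) _),
          lintegral_finsetSum _ (fun j _ => (hXm j).const_mul _)]
        simp only [lintegral_const, measure_univ, mul_one]
        congr 2
        exact Finset.sum_congr rfl fun j _ => lintegral_const_mul _ (hXm j)
    _ ≤ 1 + ∑ j, ENNReal.ofReal (t * z j) * ENNReal.ofReal (meanMatrix P X k j)
          + ENNReal.ofReal (t ^ 2) * ENNReal.ofReal C := by
        gcongr with j
        rw [meanMatrix, ENNReal.ofReal_toReal (hfin k j)]
    _ = ENNReal.ofReal (1 + t * ∑ j, meanMatrix P X k j * z j + t ^ 2 * C) := by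
        have hS : 0 ≤ ∑ j, meanMatrix P X k j * z j :=
          Finset.sum_nonneg fun j _ => mul_nonneg (hM j) (hz j)
        rw [ENNReal.ofReal_add (by positivity) (by positivity),
          ENNReal.ofReal_add (by positivity) (by positivity), ENNReal.ofReal_one,
          ENNReal.ofReal_mul (by positivity : (0 : ℝ) ≤ t ^ 2), Finset.mul_sum,
          ENNReal.ofReal_sum_of_nonneg
            (fun j _ => mul_nonneg ht0 (mul_nonneg (hM j) (hz j)))]
        congr 2
        refine Finset.sum_congr rfl fun j _ => ?_
        rw [← ENNReal.ofReal_mul (mul_nonneg ht0 (hz j))]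
        congr 1; ring

lemma sc_mono {d : ℕ} {Ω : Type*} [MeasurableSpace Ω]
    (P : Fin d → Measure Ω) (X : ℕ → Ω → Fin d → ℕ) (n : ℕ) : Monotone (genFun P X n) := by
  intro q q' h k
  refine lintegral_mono fun ω => ?_
  exact Finset.prod_le_prod' fun j _ => pow_le_pow_left' (h j) _

lemma sc_one_le {d : ℕ} {Ω : Type*} [MeasurableSpace Ω]
    (P : Fin d → Measure Ω) (X : ℕ → Ω → Fin d → ℕ)
    (hprob : ∀ k, IsProbabilityMeasure (P k)) (n : ℕ) (k : Fin d) :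
    genFun P X n (fun _ => 1) k = 1 := by
  have := hprob k
  simp [genFun]

lemma sc_cont {d : ℕ} {Ω : Type*} [MeasurableSpace Ω]
    (P : Fin d → Measure Ω) (X : ℕ → Ω → Fin d → ℕ) (hcont : GenFunContinuous P X) (k : Fin d) :
    ContinuousOn (fun x => genFun P X 1 (scQ x) k) {x : Fin d → ℝ | ∀ k, 0 ≤ x k} := by
  refine (hcont k).comp (f := scQ) ?_ ?_
  · refine Continuous.continuousOn (continuous_pi fun j => ?_)
    exact ENNReal.continuous_ofReal.comp (continuous_const.add (continuous_apply j))
  · intro x hx j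
    have := hx j
    simp only [scQ, ENNReal.ofReal_pos]
    linarith

lemma sc_small {d : ℕ} (hd : 0 < d) {Ω : Type*} [MeasurableSpace Ω]
    (P : Fin d → Measure Ω) (X : ℕ → Ω → Fin d → ℕ)
    (hprob : ∀ k, IsProbabilityMeasure (P k)) (hmeas : ∀ n, Measurable (X n))
    (hsub : Subcritical P X) (hcont : GenFunContinuous P X) :
    ∃ a0 > 0, ∀ x : Fin d → ℝ, (∀ k, 0 ≤ x k) → 0 < ∑ k, x k → ∑ k, x k ≤ a0 →
      ¬ ∀ k, ENNReal.ofReal (1 + x k) ≤ genFun P X 1 (scQ x) k := by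
  have hM : ∀ k j, 0 ≤ meanMatrix P X k j := fun k j => ENNReal.toReal_nonneg
  obtain ⟨δ, hδ, hmat⟩ := sc_mat hd (meanMatrix P X) hM hsub.2
  have hev : ∀ᶠ x in nhdsWithin (0 : Fin d → ℝ) {x : Fin d → ℝ | ∀ k, 0 ≤ x k},
      ∀ k, genFun P X 1 (scQ x) k < 2 := by
    refine eventually_all.2 fun k => ?_
    have h0 : (0 : Fin d → ℝ) ∈ {x : Fin d → ℝ | ∀ k, 0 ≤ x k} := fun k => le_rfl
    have h := sc_cont P X hcont k 0 h0
    refine h.eventually_lt_const ?_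
    have : (scQ (0 : Fin d → ℝ)) = fun _ => 1 := by funext j; simp [scQ]
    show genFun P X 1 (scQ (0 : Fin d → ℝ)) k < 2
    rw [this, sc_one_le P X hprob]
    exact one_lt_two
  obtain ⟨η, hη, hball⟩ := Metric.mem_nhdsWithin_iff.1 hev
  set ε := η / 2 with hε
  have hε0 : 0 < ε := by positivity
  have hfin : ∀ k, genFun P X 1 (scQ fun _ => ε) k ≤ ENNReal.ofReal 2 := by
    intro k
    have hmem : (fun _ => ε : Fin d → ℝ) ∈ Metric.ball (0 : Fin d → ℝ) η ∩ {x | ∀ k, 0 ≤ x k} := by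
      refine ⟨?_, fun k => hε0.le⟩
      rw [Metric.mem_ball, dist_pi_lt_iff hη]
      intro j
      rw [Pi.zero_apply, Real.dist_eq, sub_zero, abs_of_pos hε0]
      linarith
    have := (hball hmem k).le
    simpa using this
  refine ⟨min ε (δ * ε ^ 2 / 2), by positivity, fun x hx hpos hle hcon => ?_⟩
  set σ := ∑ k, x k with hσ
  have hσε : σ ≤ ε := hle.trans (min_le_left _ _)
  have hσδ : σ ≤ δ * ε ^ 2 / 2 := hle.trans (min_le_right _ _)
  have hxσ : ∀ k, x k ≤ σ := fun k =>
    Finset.single_le_sum (f := x) (fun j _ => hx j) (Finset.mem_univ k)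
  refine hmat (fun k => x k / σ) (fun k => div_nonneg (hx k) hpos.le)
    (by rw [← Finset.sum_div, ← hσ, div_self hpos.ne']) fun k => ?_
  let z : Fin d → ℝ := fun j => ε * (x j / σ)
  have hz : ∀ j, 0 ≤ z j := fun j => mul_nonneg hε0.le (div_nonneg (hx j) hpos.le)
  have hzε : ∀ j, z j ≤ ε := fun j =>
    mul_le_of_le_one_right hε0.le ((div_le_one hpos).2 (hxσ j))
  have hxz : x = fun j => (σ / ε) * z j := by
    funext j
    simp only [z]
    field_simp
  have hq := sc_quad P X hprob hmeas hsub.1 (σ / ε) (by positivity)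
    ((div_le_one hε0).2 hσε) z hz k 2 (by norm_num)
    ((sc_mono P X 1 (fun j => ENNReal.ofReal_le_ofReal (by linarith [hzε j])) k).trans (hfin k))
  rw [← hxz] at hq
  have hr := (hcon k).trans hq
  have hS : 0 ≤ ∑ j, meanMatrix P X k j * z j :=
    Finset.sum_nonneg fun j _ => mul_nonneg (hM k j) (hz j)
  rw [ENNReal.ofReal_le_ofReal_iff (by positivity)] at hr
  have hS2 : ∑ j, meanMatrix P X k j * z j = ε * ∑ j, meanMatrix P X k j * (x j / σ) := by
    rw [Finset.mul_sum]
    exact Finset.sum_congr rfl fun j _ => by simp only [z]; ring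
  rw [hS2] at hr
  set Y := ∑ j, meanMatrix P X k j * (x j / σ)
  have h1 : x k ≤ σ * Y + σ * (σ * 2 / ε ^ 2) := by
    have e1 : σ / ε * (ε * Y) = σ * Y := by field_simp
    have e2 : (σ / ε) ^ 2 * 2 = σ * (σ * 2 / ε ^ 2) := by field_simp
    rw [e1, e2] at hr
    linarith
  have h2 : σ * 2 / ε ^ 2 ≤ δ := by
    rw [div_le_iff₀ (by positivity)]; linarith
  rw [div_le_iff₀ hpos]
  have := mul_le_mul_of_nonneg_left h2 hpos.le
  linarith

lemma sc_lower {d : ℕ} {Ω : Type*} [MeasurableSpace Ω]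
    (P : Fin d → Measure Ω) (X : ℕ → Ω → Fin d → ℕ) (hmeas : ∀ n, Measurable (X n))
    (n : ℕ) (q : Fin d → ℝ≥0∞) (c : ℝ≥0∞) (k : Fin d) (A : Set (Fin d → ℕ))
    (h : ∀ m ∈ A, c ≤ ∏ j, q j ^ m j) :
    c * P k {ω | X n ω ∈ A} ≤ genFun P X n q k := by
  have hA : MeasurableSet {ω | X n ω ∈ A} := hmeas n (MeasurableSet.of_discrete)
  rw [← lintegral_indicator_const hA]
  refine lintegral_mono fun ω => ?_
  by_cases hω : X n ω ∈ A
  · rw [Set.indicator_of_mem (show ω ∈ {ω | X n ω ∈ A} from hω)]; exact h _ hω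
  · rw [Set.indicator_of_notMem (show ω ∉ {ω | X n ω ∈ A} from hω)]; exact zero_le

lemma sc_le_prod {d : ℕ} (q : Fin d → ℝ≥0∞) (hq : ∀ k, 1 ≤ q k) (m : Fin d → ℕ) (j : Fin d)
    (hj : 1 ≤ m j) : q j ≤ ∏ j, q j ^ m j := by
  calc q j ≤ q j ^ m j := le_self_pow (hq j) (by omega)
    _ ≤ ∏ j, q j ^ m j :=
      Finset.single_le_prod' (f := fun j => q j ^ m j) (fun i _ => one_le_pow_of_one_le' (hq i) _)
        (Finset.mem_univ j)

lemma sc_large {d : ℕ} (hd : 0 < d) {Ω : Type*} [MeasurableSpace Ω]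
    (P : Fin d → Measure Ω) (X : ℕ → Ω → Fin d → ℕ)
    (hprob : ∀ k, IsProbabilityMeasure (P k)) (hmeas : ∀ n, Measurable (X n))
    (hiter : ∀ n q, (genFun P X 1)^[n] q = genFun P X n q)
    (hPR : PositiveRegular P X) (hNS : NonSingular P X) :
    ∃ b0 : ℝ, ∀ x : Fin d → ℝ, (∀ k, 0 ≤ x k) → b0 ≤ ∑ k, x k →
      ¬ ∀ k, genFun P X 1 (scQ x) k ≤ ENNReal.ofReal (1 + x k) := by
  have hd' : (0 : ℝ) < d := by exact_mod_cast hd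
  have : Nonempty (Fin d) := ⟨⟨0, hd⟩⟩
  obtain ⟨N, hN⟩ := hPR
  obtain ⟨k0, hk0⟩ := hNS
  obtain ⟨kj, hkj⟩ := Finite.exists_min (fun p : Fin d × Fin d => P p.1 {ω | 1 ≤ X N ω p.2})
  have := hprob kj.1
  have := hprob k0
  set pe := P kj.1 {ω | 1 ≤ X N ω kj.2} with hpe
  have hpe0 : 0 < pe := hN _ _
  have hpet : pe ≠ ⊤ := measure_ne_top _ _
  set se := P k0 {ω | 2 ≤ ∑ j, X 1 ω j} with hse
  have hset : se ≠ ⊤ := measure_ne_top _ _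
  set p := pe.toReal
  set s := se.toReal
  have hp : 0 < p := ENNReal.toReal_pos hpe0.ne' hpet
  have hs : 0 < s := ENNReal.toReal_pos hk0.ne' hset
  have hpp : pe = ENNReal.ofReal p := (ENNReal.ofReal_toReal hpet).symm
  have hss : se = ENNReal.ofReal s := (ENNReal.ofReal_toReal hset).symm
  refine ⟨d / (p ^ 2 * s), fun x hx hb hcon => ?_⟩
  obtain ⟨j, hj⟩ := Finite.exists_max x
  have hq1 : ∀ k, 1 ≤ scQ x k := fun k => by
    rw [scQ, ENNReal.one_le_ofReal]; linarith [hx k]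
  have hle : genFun P X 1 (scQ x) ≤ scQ x := hcon
  have hleN : ∀ n, genFun P X n (scQ x) ≤ scQ x := by
    intro n
    rw [← hiter]
    induction n with
    | zero => exact le_rfl
    | succ n ih =>
      rw [Function.iterate_succ_apply]
      exact ((sc_mono P X 1).iterate n hle).trans ih
  have h1 : ∀ k, ENNReal.ofReal ((1 + x j) * p) ≤ scQ x k := by
    intro k
    refine le_trans ?_ (hleN N k)
    refine le_trans ?_ (sc_lower P X hmeas N (scQ x) (scQ x j) k {m | 1 ≤ m j}
      fun m hm => sc_le_prod _ hq1 m j hm)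
    rw [ENNReal.ofReal_mul (by linarith [hx j]), ← hpp]
    exact mul_le_mul_right (hkj (k, j)) _
  set m : ℝ≥0∞ := max 1 (ENNReal.ofReal ((1 + x j) * p)) with hm
  have hmq : ∀ k, m ≤ scQ x k := fun k => max_le (hq1 k) (h1 k)
  have h2 : m ^ 2 * se ≤ scQ x k0 := by
    refine le_trans ?_ (hcon k0)
    refine sc_lower P X hmeas 1 (scQ x) (m ^ 2) k0 {n | 2 ≤ ∑ j, n j} fun n hn => ?_
    calc m ^ 2 ≤ m ^ (∑ j, n j) := pow_le_pow_right' (le_max_left _ _) hn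
      _ = ∏ j, m ^ n j := (Finset.prod_pow_eq_pow_sum _ _ _).symm
      _ ≤ _ := Finset.prod_le_prod' fun j _ => pow_le_pow_left' (hmq j) _
  have h3 : ENNReal.ofReal (((1 + x j) * p) ^ 2 * s) ≤ ENNReal.ofReal (1 + x k0) := by
    have hxj := hx j
    rw [ENNReal.ofReal_mul (by positivity), ← hss, ENNReal.ofReal_pow (by positivity)]
    refine le_trans ?_ h2
    gcongr
    exact le_max_right _ _
  rw [ENNReal.ofReal_le_ofReal_iff (by linarith [hx k0])] at h3
  have h4 : x k0 ≤ x j := hj k0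
  have h5 : ∑ k, x k ≤ d * x j := by
    calc ∑ k, x k ≤ ∑ k : Fin d, x j := Finset.sum_le_sum fun k _ => hj k
      _ = d * x j := by simp
  have h6 : 1 / (p ^ 2 * s) ≤ x j := by
    have := hb.trans h5
    have e : (d : ℝ) / (p ^ 2 * s) = d * (1 / (p ^ 2 * s)) := by ring
    rw [e] at this
    exact le_of_mul_le_mul_left this hd'
  have hps : 0 < p ^ 2 * s := by positivity
  rw [div_le_iff₀ hps] at h6
  have h7 : 0 < 1 + x j := by linarith [hx j]
  have h8 : (1 + x j) * ((1 + x j) * (p ^ 2 * s)) ≤ (1 + x j) * 1 := by nlinarith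
  have h9 := le_of_mul_le_mul_left h8 h7
  nlinarith

/-- (Main theorem, `d`-type case.) Let `X` be a `d`-type branching
process whose mean matrix has largest eigenvalue `ρ < 1` (subcritical), which is
positive regular and non-singular, and whose generating function components are
continuous from `(0,∞]^d` to `(0,∞]`. Then the generating function has a fixed point
`q ∈ (1,∞)^d`, i.e. there exists a conjugate (supercritical) branching process. -/
theorem exists_conjugate_fixed_point
    {d : ℕ} {Ω : Type*} [MeasurableSpace Ω]
    (P : Fin d → Measure Ω) (X : ℕ → Ω → Fin d → ℕ)
    (hprob : ∀ k, IsProbabilityMeasure (P k))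
    (hmeas : ∀ n, Measurable (X n))
    (hiter : ∀ n q, (genFun P X 1)^[n] q = genFun P X n q)
    (hsub : Subcritical P X)
    (hPR : PositiveRegular P X)
    (hNS : NonSingular P X)
    (hcont : GenFunContinuous P X) :
    ∃ q : Fin d → ℝ≥0∞, (∀ k, 1 < q k ∧ q k ≠ ⊤) ∧ genFun P X 1 q = q := by
  have hd : 0 < d := by
    obtain ⟨k, -⟩ := hNS
    exact k.pos
  obtain ⟨a0, ha0, hsmall⟩ := sc_small hd P X hprob hmeas hsub hcont
  obtain ⟨b0, hlarge⟩ := sc_large hd P X hprob hmeas hiter hPR hNS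
  set b := max b0 (a0 + 1) with hb
  have hab : a0 < b := lt_of_lt_of_le (by linarith) (le_max_right _ _)
  have hb0 : 0 < b := ha0.trans hab
  have hxs : ∀ x : Fin d → ℝ, (∀ k, 0 ≤ x k) → ∀ k, x k ≤ ∑ k, x k := fun x hx k =>
    Finset.single_le_sum (f := x) (fun j _ => hx j) (Finset.mem_univ k)
  have hq1 : ∀ x : Fin d → ℝ, (∀ k, 0 ≤ x k) → ∀ k, 1 ≤ scQ x k := fun x hx k => by
    rw [scQ, ENNReal.one_le_ofReal]; linarith [hx k]
  have hG1 : ∀ x : Fin d → ℝ, (∀ k, 0 ≤ x k) → ∀ k, 1 ≤ genFun P X 1 (scQ x) k := by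
    intro x hx k
    rw [← sc_one_le P X hprob 1 k]
    exact sc_mono P X 1 (fun j => hq1 x hx j) k
  let T : (Fin d → ℝ) → Fin d → ℝ := fun x k =>
    (min (genFun P X 1 (scQ x) k) (ENNReal.ofReal (2 + b))).toReal - 1
  have hne : ∀ x k, min (genFun P X 1 (scQ x) k) (ENNReal.ofReal (2 + b)) ≠ ⊤ := fun x k =>
    ne_top_of_le_ne_top ENNReal.ofReal_ne_top (min_le_right _ _)
  have hTle : ∀ x : Fin d → ℝ, (∀ k, 0 ≤ x k) → ∑ k, x k ≤ b → ∀ k, T x k ≤ x k →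
      genFun P X 1 (scQ x) k = ENNReal.ofReal (1 + T x k) := by
    intro x hx hs k hk
    have e : min (genFun P X 1 (scQ x) k) (ENNReal.ofReal (2 + b))
        = ENNReal.ofReal (1 + T x k) := by
      simp only [T]
      rw [add_sub_cancel, ENNReal.ofReal_toReal (hne x k)]
    rcases min_choice (genFun P X 1 (scQ x) k) (ENNReal.ofReal (2 + b)) with h | h
    · rw [← e, h]
    · exfalso
      rw [h] at e
      have h1 : 2 + b ≤ 1 + T x k := by
        by_contra hcon
        push Not at hcon
        exact absurd e.symm (((ENNReal.ofReal_lt_ofReal_iff (by linarith)).2 hcon).ne)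
      have := hxs x hx k
      linarith
  obtain ⟨x, hx, hxa, hxb, hfix⟩ := sc_cone hd T
    (by
      refine continuousOn_pi.2 fun k => ?_
      refine ContinuousOn.sub ?_ continuousOn_const
      exact ENNReal.continuousOn_toReal.comp
        ((sc_cont P X hcont k).inf continuousOn_const) fun x _ => hne x k)
    (by
      intro x hx k
      simp only [T]
      rw [sub_nonneg, ← ENNReal.toReal_one]
      refine ENNReal.toReal_mono (hne x k) (le_min (hG1 x hx k) ?_)
      rw [ENNReal.one_le_ofReal]; linarith)
    a0 b ha0 hab
    (by
      intro x hx hs hcon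
      refine hsmall x hx (by rw [hs]; exact ha0) hs.le fun k => ?_
      have h1 := hcon k
      simp only [T] at h1
      refine le_trans ?_ (min_le_left _ (ENNReal.ofReal (2 + b)))
      exact ENNReal.ofReal_le_of_le_toReal (by linarith))
    (by
      intro x hx hs hcon
      refine hlarge x hx (by rw [hs]; exact le_max_left _ _) fun k => ?_
      rw [hTle x hx hs.le k (hcon k)]
      exact ENNReal.ofReal_le_ofReal (by linarith [hcon k]))
  have hfp : genFun P X 1 (scQ x) = scQ x := by
    funext k
    rw [hTle x hx hxb k (by rw [hfix]), hfix]
    rfl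
  refine ⟨scQ x, fun k => ⟨?_, ENNReal.ofReal_ne_top⟩, hfp⟩
  obtain ⟨N, hN⟩ := hPR
  have hfN : genFun P X N (scQ x) = scQ x := by
    rw [← hiter]
    exact Function.iterate_fixed hfp N
  obtain ⟨j, hj⟩ : ∃ j, 0 < x j := by
    by_contra hcon
    push Not at hcon
    have : ∑ k, x k ≤ 0 := Finset.sum_nonpos fun k _ => hcon k
    linarith
  have := hprob k
  have hmA : MeasurableSet {ω | 1 ≤ X N ω j} :=
    hmeas N (MeasurableSet.of_discrete (s := {m : Fin d → ℕ | 1 ≤ m j}))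
  have hlow : 1 + ENNReal.ofReal (x j) * P k {ω | 1 ≤ X N ω j} ≤ genFun P X N (scQ x) k := by
    have e : 1 + ENNReal.ofReal (x j) * P k {ω | 1 ≤ X N ω j}
        = ∫⁻ ω, (1 + ({ω | 1 ≤ X N ω j} : Set Ω).indicator
            (fun _ => ENNReal.ofReal (x j)) ω) ∂ (P k) := by
      rw [lintegral_add_left measurable_const, lintegral_indicator_const hmA]
      simp
    rw [e]
    refine lintegral_mono fun ω => ?_
    by_cases hω : 1 ≤ X N ω j
    · rw [Set.indicator_of_mem (show ω ∈ {ω | 1 ≤ X N ω j} from hω)]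
      refine le_trans ?_ (sc_le_prod _ (hq1 x hx) (X N ω) j hω)
      rw [scQ, ENNReal.ofReal_add zero_le_one (hx j), ENNReal.ofReal_one]
    · rw [Set.indicator_of_notMem (show ω ∉ {ω | 1 ≤ X N ω j} from hω), add_zero]
      exact Finset.one_le_prod' fun i _ => one_le_pow_of_one_le' (hq1 x hx i) _
  rw [hfN] at hlow
  refine lt_of_lt_of_le ?_ hlow
  refine ENNReal.lt_add_right ENNReal.one_ne_top ?_
  exact mul_ne_zero (ENNReal.ofReal_pos.2 hj).ne' (hN k j).ne'
end
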